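/- arXiv:math/0304001 — 2 statements merged into one kernel-verified Lean document; each statement's English description precedes it below -/
import Mathlib

section
/- The operators t_n, d^n_i, s^n_i on the spaces C^n_H(B) define a cocyclic object in the category of complex vector spaces: they satisfy the cosimplicial identities together with t_n d^n_i = d^n_{i-1} t_{n-1} for i ≥ 1, t_n d^n_0 = d^n_n, t_n s^n_i = s^n_{i-1} t_{n+1} for i ≥ 1, t_n s^n_0 = s^n_n t_{n+1}², and t_n^{n+1} = id. -/
open scoped TensorProduct

noncomputable section

/-- A Hopf `ℂ`-algebra with invertible antipode, together with a chosen finite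
(Sweedler) representation of the comultiplication: `Δ ω = ∑_{p ∈ Δl ω} p.1 ⊗ p.2`. -/
structure HopfData (H : Type) [Ring H] [HopfAlgebra ℂ H] where
  /-- the inverse of the antipode -/
  Sinv : H →ₗ[ℂ] H
  Sinv_antipode : ∀ ω : H, Sinv (HopfAlgebra.antipode (R := ℂ) ω) = ω
  antipode_Sinv : ∀ ω : H, HopfAlgebra.antipode (R := ℂ) (Sinv ω) = ω
  /-- a chosen list representation of the comultiplication -/
  Δl : H → List (H × H)
  Δl_repr : ∀ ω : H,
    (Coalgebra.comul (R := ℂ) ω : H ⊗[ℂ] H) = ((Δl ω).map fun p => p.1 ⊗ₜ[ℂ] p.2).sum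

variable {H : Type} [Ring H] [HopfAlgebra ℂ H]

/-- the counit, as a `ℂ`-valued function -/
def epsi (ω : H) : ℂ := Coalgebra.counit (R := ℂ) ω

/-- Iterated Sweedler decomposition: `sw n ω` represents
`Δⁿ ω = ∑_v v 0 ⊗ ⋯ ⊗ v n`, where `Δⁿ = (ι ⊗ Δ) Δ^{n-1}`. -/
def HopfData.sw (D : HopfData H) : (n : ℕ) → H → List (Fin (n + 1) → H)
  | 0, ω => [fun _ => ω]
  | n + 1, ω =>
    (D.sw n ω).flatMap fun v =>
      (D.Δl (v (Fin.last n))).map fun p =>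
        Fin.snoc (Function.update v (Fin.last n) p.1) p.2

/-- A right `H`-module structure (over `ℂ`), recorded as the antihomomorphism
`act : H → End(B)`, so `act ω b` stands for `b ◁ ω`. -/
structure RAct (H : Type) [Ring H] [HopfAlgebra ℂ H] (B : Type) [AddCommGroup B]
    [Module ℂ B] where
  act : H →ₗ[ℂ] B →ₗ[ℂ] B
  act_one : act 1 = LinearMap.id
  act_mul : ∀ ω η : H, act (ω * η) = (act η) ∘ₗ (act ω)

/-- A unital right `H`-module algebra structure on `B`:
`(b₁ b₂) ◁ ω = ∑ (b₁ ◁ ω₍₀₎)(b₂ ◁ ω₍₁₎)` and `1 ◁ ω = ε(ω) 1`. -/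
structure MAlg (D : HopfData H) (B : Type) [Ring B] [Algebra ℂ B] extends RAct H B where
  act_mul_mul : ∀ (ω : H) (b₁ b₂ : B),
    act ω (b₁ * b₂) = ((D.Δl ω).map fun p => act p.1 b₁ * act p.2 b₂).sum
  act_algOne : ∀ ω : H, act ω (1 : B) = epsi ω • (1 : B)


/-- the action as a plain function: `fn ω b = b ◁ ω` -/
def RAct.fn {H : Type} [Ring H] [HopfAlgebra ℂ H] {B : Type} [AddCommGroup B] [Module ℂ B]
    (A : RAct H B) : H → B → B := fun ω x => A.act ω x

/-- the action of a module algebra as a plain function -/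
def MAlg.fn {H : Type} [Ring H] [HopfAlgebra ℂ H] {B : Type} [Ring B] [Algebra ℂ B]
    {D : HopfData H} (A : MAlg D B) : H → B → B := A.toRAct.fn

/-- The space of `ℂ`-valued functions of one `H`-variable and `n+1` `B`-variables;
(multi)linear such functions correspond to linear functionals on `H ⊗ B^{⊗(n+1)}`. -/
abbrev Raw (H B : Type) (n : ℕ) := H → (Fin (n + 1) → B) → ℂ

section Raw

variable {H : Type} [Ring H] [HopfAlgebra ℂ H] {B : Type} [Ring B] [Algebra ℂ B] {n : ℕ}

/-- `f` is linear in the `H`-variable and in each `B`-variable separately, i.e. `f`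
is (the restriction of) a linear functional on `H ⊗ B^{⊗(n+1)}`. -/
def IsML (f : Raw H B n) : Prop :=
  (∀ ω η b, f (ω + η) b = f ω b + f η b) ∧
  (∀ (c : ℂ) ω b, f (c • ω) b = c * f ω b) ∧
  (∀ ω b (i : Fin (n + 1)) (x y : B),
    f ω (Function.update b i (x + y)) =
      f ω (Function.update b i x) + f ω (Function.update b i y)) ∧
  (∀ ω b (i : Fin (n + 1)) (c : ℂ) (x : B),
    f ω (Function.update b i (c • x)) = c * f ω (Function.update b i x))

/-- `H`-invariance of the functional `f` on `H ⊗ B^{⊗(n+1)}`: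
`(ω ▷ f)(η ⊗ b₀ ⊗ ⋯ ⊗ bₙ) = f(S⁻¹(ω₍₀₎) η ω₍₁₎ ⊗ b₀ ◁ ω₍₂₎ ⊗ ⋯ ⊗ bₙ ◁ ω₍ₙ₊₂₎)`
equals `ε(ω) f(η ⊗ b₀ ⊗ ⋯ ⊗ bₙ)`. -/
def IsInv (D : HopfData H) (act : H → B → B) (f : Raw H B n) : Prop :=
  ∀ (ω η : H) (b : Fin (n + 1) → B),
    ((D.sw (n + 2) ω).map fun v =>
        f (D.Sinv (v 0) * η * v 1) fun i => act (v i.succ.succ) (b i)).sum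
      = epsi ω * f η b

/-- membership in the equivariant cochain space `C^n_H(B)` -/
def InC (D : HopfData H) (act : H → B → B) (f : Raw H B n) : Prop :=
  IsML f ∧ IsInv D act f

/-- the cyclic operator
`(tₙ f)(ω ⊗ b₀ ⊗ ⋯ ⊗ bₙ) = f(ω₍₀₎ ⊗ bₙ ◁ ω₍₁₎ ⊗ b₀ ⊗ ⋯ ⊗ b_{n-1})` -/
def tRaw (D : HopfData H) (act : H → B → B) (f : Raw H B n) : Raw H B n :=
  fun ω b =>
    ((D.Δl ω).map fun p =>
      f p.1 (Fin.cons (act p.2 (b (Fin.last n))) fun i : Fin n => b i.castSucc)).sum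

/-- merging the `i`-th and `(i+1)`-st entries of a `(n+2)`-tuple by multiplication -/
def contract (i : Fin (n + 1)) (b : Fin (n + 2) → B) : Fin (n + 1) → B :=
  fun j =>
    if (j : ℕ) < (i : ℕ) then b j.castSucc
    else if (j : ℕ) = (i : ℕ) then b j.castSucc * b j.succ
    else b j.succ

/-- the coface operators `dⁿᵢ : C^{n} → C^{n+1}` (`i < n+1` multiplies adjacent entries;
the last one is `d_{n+1} = t ∘ d₀`) -/
def dRaw (D : HopfData H) (act : H → B → B) (i : Fin (n + 2)) (f : Raw H B n) :
    Raw H B (n + 1) :=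
  if h : (i : ℕ) < n + 1 then fun ω b => f ω (contract ⟨i, h⟩ b)
  else tRaw D act fun ω b => f ω (contract 0 b)

/-- the codegeneracy operators `sⁿᵢ : C^{n+1} → C^n`, inserting a `1` after the `i`-th entry -/
def sRaw (i : Fin (n + 1)) (f : Raw H B (n + 1)) : Raw H B n :=
  fun ω b => f ω (Fin.insertNth i.succ 1 b)

/-- the Hochschild coboundary `b = ∑ (-1)ⁱ dᵢ` -/
def bRaw (D : HopfData H) (act : H → B → B) (f : Raw H B n) : Raw H B (n + 1) :=
  fun ω b => ∑ i : Fin (n + 2), ((-1 : ℂ) ^ (i : ℕ)) * dRaw D act i f ω b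

/-- cyclicity: `λ f = (-1)ⁿ tₙ f = f` -/
def IsCyc (D : HopfData H) (act : H → B → B) (f : Raw H B n) : Prop :=
  ∀ ω b, ((-1 : ℂ) ^ n) * tRaw D act f ω b = f ω b

/-- an `n`-cocycle of the cyclic complex `(Ker(1-λ), b)` computing `HC^n_H(B)` -/
def IsCocycle (D : HopfData H) (act : H → B → B) (f : Raw H B n) : Prop :=
  InC D act f ∧ IsCyc D act f ∧ ∀ ω b, bRaw D act f ω b = 0

end Raw


/-! ### Sweedler calculus -/

/-- Sweedler sum `∑ F ω₍₀₎ ω₍₁₎`. -/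
def Sw (D : HopfData H) {M : Type*} [AddCommMonoid M] (ω : H) (F : H → H → M) : M :=
  ((D.Δl ω).map fun p => F p.1 p.2).sum

abbrev Lin {V M : Type*} [AddCommGroup V] [Module ℂ V] [AddCommGroup M] [Module ℂ M]
    (g : V → M) : Prop := IsLinearMap ℂ g

set_option linter.unusedSectionVars false

section Sweedler

variable (D : HopfData H) {M : Type*} [AddCommGroup M] [Module ℂ M]

theorem Sw_congr {ω : H} {F G : H → H → M} (h : ∀ x y, F x y = G x y) : Sw D ω F = Sw D ω G := by
  have : F = G := by funext x y; exact h x y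
  rw [this]

theorem map_Sw {N : Type*} [AddCommGroup N] [Module ℂ N] {g : M → N} (hg : Lin g) (ω : H)
    (F : H → H → M) : g (Sw D ω F) = Sw D ω fun x y => g (F x y) := by
  have := map_list_sum (hg.mk' g) ((D.Δl ω).map fun p => F p.1 p.2)
  simpa [Sw, Function.comp_def] using this

theorem list_sum_add {α : Type*} (l : List α) (f g : α → M) :
    (l.map fun a => f a + g a).sum = (l.map f).sum + (l.map g).sum := by
  induction l with
  | nil => simp
  | cons a l ih => simp only [List.map_cons, List.sum_cons, ih]; abel

theorem list_sum_smul {α : Type*} (l : List α) (c : ℂ) (f : α → M) :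
    (l.map fun a => c • f a).sum = c • (l.map f).sum := by
  induction l with
  | nil => simp
  | cons a l ih => simp only [List.map_cons, List.sum_cons, ih, smul_add]

theorem lin_list {V α : Type*} [AddCommGroup V] [Module ℂ V] (l : List α) (F : V → α → M)
    (h : ∀ a, Lin fun t => F t a) : Lin fun t => (l.map (F t)).sum := by
  constructor
  · intro s t
    rw [← list_sum_add]
    exact congrArg List.sum (List.map_congr_left fun a _ => (h a).map_add s t)
  · intro c t
    rw [← list_sum_smul]
    exact congrArg List.sum (List.map_congr_left fun a _ => (h a).map_smul c t)

theorem lin_Sw_param {V : Type*} [AddCommGroup V] [Module ℂ V] (ω : H) (F : V → H → H → M)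
    (h : ∀ x y, Lin fun t => F t x y) : Lin fun t => Sw D ω (F t) :=
  lin_list (D.Δl ω) (fun t (p : H × H) => F t p.1 p.2) fun a => h a.1 a.2

/-- A bilinear function as a linear map on the tensor square. -/
def bil (F : H → H → M) (h1 : ∀ y, Lin fun x => F x y) (h2 : ∀ x, Lin fun y => F x y) :
    H →ₗ[ℂ] H →ₗ[ℂ] M :=
  LinearMap.mk₂ ℂ F (fun a b c => (h1 c).map_add a b) (fun r a c => (h1 c).map_smul r a)
    (fun a b c => (h2 a).map_add b c) (fun r a c => (h2 a).map_smul r c)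

theorem Sw_eq (ω : H) (F : H → H → M) (h1 : ∀ y, Lin fun x => F x y)
    (h2 : ∀ x, Lin fun y => F x y) :
    Sw D ω F = TensorProduct.lift (bil F h1 h2) (Coalgebra.comul (R := ℂ) ω) := by
  rw [D.Δl_repr, map_list_sum, List.map_map]
  rfl

theorem lin_Sw (F : H → H → M) (h1 : ∀ y, Lin fun x => F x y)
    (h2 : ∀ x, Lin fun y => F x y) : Lin fun ω => Sw D ω F := by
  simp only [Sw_eq D _ F h1 h2]
  constructor
  · intro x y; simp
  · intro c x; simp

theorem Sw_comm (ω η : H) (F : H → H → H → H → M) :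
    Sw D ω (fun x y => Sw D η fun a b => F x y a b)
      = Sw D η (fun a b => Sw D ω fun x y => F x y a b) := by
  unfold Sw
  induction D.Δl ω with
  | nil => simp
  | cons p l ih => simp only [List.map_cons, List.sum_cons, ih, list_sum_add]

theorem Sw_coassoc (ω : H) (F : H → H → H → M) (h1 : ∀ y z, Lin fun x => F x y z)
    (h2 : ∀ x z, Lin fun y => F x y z) (h3 : ∀ x y, Lin fun z => F x y z) :
    Sw D ω (fun x y => Sw D x fun a b => F a b y) =
      Sw D ω (fun x y => Sw D y fun b c => F x b c) := by
  let G : H →ₗ[ℂ] (H ⊗[ℂ] H) →ₗ[ℂ] M := 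
    { toFun := fun x => TensorProduct.lift (bil (F x) (h2 x) (h3 x))
      map_add' := by intro x y; ext a b; simp [bil, (h1 a b).map_add]
      map_smul' := by intro c x; ext a b; simp [bil, (h1 a b).map_smul] }
  have e := congrArg (TensorProduct.lift G) (Coalgebra.coassoc_apply (R := ℂ) ω)
  rw [D.Δl_repr] at e
  simp only [map_list_sum, List.map_map, Function.comp_def, LinearMap.rTensor_tmul,
    LinearMap.lTensor_tmul] at e
  have e1 : ∀ p : H × H, (TensorProduct.lift G) ((TensorProduct.assoc ℂ H H H)
      (Coalgebra.comul (R := ℂ) p.1 ⊗ₜ[ℂ] p.2)) = Sw D p.1 fun a b => F a b p.2 := by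
    intro p
    rw [D.Δl_repr p.1, ← TensorProduct.mk_apply, ← LinearMap.flip_apply]
    simp only [map_list_sum, List.map_map, Function.comp_def, LinearMap.flip_apply,
      TensorProduct.mk_apply, TensorProduct.assoc_tmul, TensorProduct.lift.tmul]
    rfl
  have e2 : ∀ p : H × H, (TensorProduct.lift G) (p.1 ⊗ₜ[ℂ] Coalgebra.comul (R := ℂ) p.2)
      = Sw D p.2 fun b c => F p.1 b c := by
    intro p
    rw [Sw_eq D p.2 (F p.1) (h2 _) (h3 _)]
    rfl
  simp only [e1, e2] at e
  exact e

theorem Sw_counit_left (ω : H) (g : H → M) (h : Lin g) :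
    Sw D ω (fun x y => epsi x • g y) = g ω := by
  have e := congrArg (TensorProduct.lift ((LinearMap.lsmul ℂ M).flip ∘ₗ h.mk' g).flip)
    (Coalgebra.rTensor_counit_comul (R := ℂ) ω)
  rw [D.Δl_repr] at e
  simp only [map_list_sum, List.map_map, Function.comp_def, LinearMap.rTensor_tmul] at e
  simpa [Sw, epsi] using e

theorem Sw_counit_right (ω : H) (g : H → M) (h : Lin g) :
    Sw D ω (fun x y => epsi y • g x) = g ω := by
  have e := congrArg (TensorProduct.lift ((LinearMap.lsmul ℂ M).flip ∘ₗ h.mk' g))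
    (Coalgebra.lTensor_counit_comul (R := ℂ) ω)
  rw [D.Δl_repr] at e
  simp only [map_list_sum, List.map_map, Function.comp_def, LinearMap.lTensor_tmul] at e
  simpa [Sw, epsi] using e

theorem Sw_mul (ω η : H) (F : H → H → M) (h1 : ∀ y, Lin fun x => F x y)
    (h2 : ∀ x, Lin fun y => F x y) :
    Sw D (ω * η) F = Sw D ω fun x y => Sw D η fun a b => F (x * a) (y * b) := by
  rw [Sw_eq D _ F h1 h2, Bialgebra.comul_mul, D.Δl_repr ω, ← List.sum_map_mul_right]
  simp only [map_list_sum, List.map_map, Function.comp_def]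
  unfold Sw
  congr 1
  refine List.map_congr_left fun p _ => ?_
  rw [D.Δl_repr η, ← List.sum_map_mul_left]
  simp only [map_list_sum, List.map_map, Function.comp_def,
    Algebra.TensorProduct.tmul_mul_tmul, TensorProduct.lift.tmul]
  rfl

theorem lin_epsi : Lin (epsi : H → ℂ) := ⟨by intro x y; simp [epsi], by intro c x; simp [epsi]⟩

theorem Sw_antipode_left (ω : H) :
    Sw D ω (fun x y => HopfAlgebra.antipode (R := ℂ) x * y) = epsi ω • (1 : H) := by
  have e := HopfAlgebra.mul_antipode_rTensor_comul_apply (R := ℂ) ω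
  rw [D.Δl_repr] at e
  simp only [map_list_sum, List.map_map, Function.comp_def, LinearMap.rTensor_tmul,
    LinearMap.mul'_apply] at e
  rw [Algebra.algebraMap_eq_smul_one] at e
  exact e

theorem Sw_antipode_right (ω : H) :
    Sw D ω (fun x y => x * HopfAlgebra.antipode (R := ℂ) y) = epsi ω • (1 : H) := by
  have e := HopfAlgebra.mul_antipode_lTensor_comul_apply (R := ℂ) ω
  rw [D.Δl_repr] at e
  simp only [map_list_sum, List.map_map, Function.comp_def, LinearMap.lTensor_tmul,
    LinearMap.mul'_apply] at e
  rw [Algebra.algebraMap_eq_smul_one] at e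
  exact e

theorem Sinv_mul (x y : H) : D.Sinv (x * y) = D.Sinv y * D.Sinv x := by
  have := HopfAlgebra.antipode_mul_antidistrib (R := ℂ) (D.Sinv y) (D.Sinv x)
  rw [D.antipode_Sinv, D.antipode_Sinv] at this
  rw [← this, D.Sinv_antipode]

theorem Sinv_one : D.Sinv 1 = 1 := by
  have := D.Sinv_antipode 1
  rwa [HopfAlgebra.antipode_one] at this

theorem lin_Sinv : Lin D.Sinv := D.Sinv.isLinear

/-- `S⁻¹(ω₍₁₎) ω₍₀₎ = ε(ω)` -/
theorem Sw_Sinv_left (ω : H) :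
    Sw D ω (fun x y => D.Sinv y * x) = epsi ω • (1 : H) := by
  have e := congrArg D.Sinv (Sw_antipode_left D ω)
  rw [map_Sw D (lin_Sinv D)] at e
  simpa [Sinv_mul, D.Sinv_antipode, Sinv_one] using e

/-- `ω₍₁₎ S⁻¹(ω₍₀₎) = ε(ω)` -/
theorem Sw_Sinv_right (ω : H) :
    Sw D ω (fun x y => y * D.Sinv x) = epsi ω • (1 : H) := by
  have e := congrArg D.Sinv (Sw_antipode_right D ω)
  rw [map_Sw D (lin_Sinv D)] at e
  simpa [Sinv_mul, D.Sinv_antipode, Sinv_one] using e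

theorem Lin.mul_l {V : Type*} [AddCommGroup V] [Module ℂ V] {A : Type*} [Ring A] [Algebra ℂ A]
    {g : V → A} (h : Lin g) (a : A) : Lin fun x => a * g x :=
  ⟨fun x y => by simp only [h.map_add, mul_add],
    fun c x => by simp only [h.map_smul, mul_smul_comm]⟩

theorem Lin.mul_r {V : Type*} [AddCommGroup V] [Module ℂ V] {A : Type*} [Ring A] [Algebra ℂ A]
    {g : V → A} (h : Lin g) (a : A) : Lin fun x => g x * a :=
  ⟨fun x y => by simp only [h.map_add, add_mul],
    fun c x => by simp only [h.map_smul, smul_mul_assoc]⟩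

theorem Lin.comp' {V W : Type*} [AddCommGroup V] [Module ℂ V] [AddCommGroup W] [Module ℂ W]
    {f : W → M} (hf : Lin f) {g : V → W} (hg : Lin g) : Lin fun x => f (g x) :=
  ⟨fun x y => by simp only [hg.map_add, hf.map_add],
    fun c x => by simp only [hg.map_smul, hf.map_smul]⟩

theorem Lin.id' {V : Type*} [AddCommGroup V] [Module ℂ V] : Lin fun x : V => x :=
  ⟨fun _ _ => rfl, fun _ _ => rfl⟩

theorem Lin.smul_c {V : Type*} [AddCommGroup V] [Module ℂ V] {g : V → M} (h : Lin g) (c : ℂ) :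
    Lin fun x => c • g x :=
  ⟨fun x y => by simp only [h.map_add, smul_add],
    fun d x => by simp only [h.map_smul, smul_comm c d]⟩

theorem Lin.smul_v {V : Type*} [AddCommGroup V] [Module ℂ V] {g : V → ℂ} (h : Lin g) (m : M) :
    Lin fun x => g x • m :=
  ⟨fun x y => by simp only [h.map_add, add_smul],
    fun d x => by simp only [h.map_smul, smul_assoc]⟩

theorem lin_tmul_r (a : H) : Lin fun x : H => a ⊗ₜ[ℂ] x := (TensorProduct.mk ℂ H H a).isLinear

theorem lin_tmul_l (a : H) : Lin fun x : H => x ⊗ₜ[ℂ] a :=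
  ((TensorProduct.mk ℂ H H).flip a).isLinear

theorem lin_antipode : Lin fun x : H => HopfAlgebra.antipode (R := ℂ) x :=
  (HopfAlgebra.antipode (R := ℂ)).isLinear

/-- The flipped `S ⊗ S` composed with `Δ`. -/
def gflip : H →ₗ[ℂ] H ⊗[ℂ] H :=
  TensorProduct.map (HopfAlgebra.antipode (R := ℂ)) (HopfAlgebra.antipode (R := ℂ)) ∘ₗ
    (TensorProduct.comm ℂ H H).toLinearMap ∘ₗ Coalgebra.comul

theorem gflip_apply (ω : H) : gflip ω = Sw D ω fun x y =>
    HopfAlgebra.antipode (R := ℂ) y ⊗ₜ[ℂ] HopfAlgebra.antipode (R := ℂ) x := by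
  simp only [gflip, LinearMap.comp_apply]
  rw [D.Δl_repr]
  simp only [map_list_sum, List.map_map, Function.comp_def]
  rfl

theorem comul_apply (ω : H) : Coalgebra.comul (R := ℂ) ω = Sw D ω fun x y => x ⊗ₜ[ℂ] y :=
  D.Δl_repr ω

theorem conv_apply {T : Type*} [Ring T] [Algebra ℂ T] (f g : H →ₗ[ℂ] T) (ω : H) :
    (WithConv.toConv f * WithConv.toConv g) ω = Sw D ω fun x y => f x * g y := by
  rw [LinearMap.convMul_apply, D.Δl_repr]
  simp only [map_list_sum, List.map_map, Function.comp_def]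
  rfl

theorem gflip_mul (D : HopfData H) :
    WithConv.toConv (gflip (H := H)) * WithConv.toConv (Coalgebra.comul (R := ℂ) (A := H)) = 1 := by
  ext ω
  rw [conv_apply D]
  simp only [gflip_apply D, comul_apply D]
  have l1 : ∀ y : H × H, Lin fun z : H ⊗[ℂ] H => z := fun _ => Lin.id'
  set S := HopfAlgebra.antipode (R := ℂ) (A := H) with hS
  have e1 : ∀ x y : H, (Sw D x fun a b => S b ⊗ₜ[ℂ] S a) * (Sw D y fun c d => c ⊗ₜ[ℂ] d)
      = Sw D x fun a b => Sw D y fun c d => (S b * c) ⊗ₜ[ℂ] (S a * d) := by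
    intro x y
    rw [map_Sw D (Lin.id'.mul_r (Sw D y fun c d => c ⊗ₜ[ℂ] d))]
    refine Sw_congr D fun a b => ?_
    rw [map_Sw D (Lin.id'.mul_l (S b ⊗ₜ[ℂ] S a))]
    refine Sw_congr D fun c d => ?_
    rw [Algebra.TensorProduct.tmul_mul_tmul]
  have hSl : Lin fun x : H => S x := lin_antipode
  simp only [e1]
  rw [Sw_coassoc D ω (fun a b y => Sw D y fun c d => (S b * c) ⊗ₜ[ℂ] (S a * d))
    (fun b y => lin_Sw_param D _ _ fun c d => (lin_tmul_r _).comp' (hSl.mul_r d))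
    (fun a y => lin_Sw_param D _ _ fun c d => (lin_tmul_l _).comp' (hSl.mul_r c))
    (fun a b => lin_Sw D _ (fun d => (lin_tmul_l _).comp' (Lin.id'.mul_l _))
      (fun c => (lin_tmul_r _).comp' (Lin.id'.mul_l _)))]
  have e2 : ∀ a r : H, (Sw D r fun b y => Sw D y fun c d => (S b * c) ⊗ₜ[ℂ] (S a * d))
      = 1 ⊗ₜ[ℂ] (S a * r) := by
    intro a r
    rw [← Sw_coassoc D r (fun b c d => (S b * c) ⊗ₜ[ℂ] (S a * d))
      (fun c d => (lin_tmul_l _).comp' (hSl.mul_r c))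
      (fun b d => (lin_tmul_l _).comp' (Lin.id'.mul_l _))
      (fun b c => (lin_tmul_r _).comp' (Lin.id'.mul_l _))]
    rw [← Sw_counit_left D r (fun r => (1 : H) ⊗ₜ[ℂ] (S a * r))
      ((lin_tmul_r _).comp' (Lin.id'.mul_l _))]
    refine Sw_congr D fun w d => ?_
    rw [← map_Sw D (lin_tmul_l (S a * d)), Sw_antipode_left, TensorProduct.smul_tmul']
  simp only [e2]
  rw [← map_Sw D (lin_tmul_r (1 : H)), Sw_antipode_left]
  rw [TensorProduct.tmul_smul, LinearMap.convOne_apply, Algebra.algebraMap_eq_smul_one]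
  rfl

theorem comul_antipode (D : HopfData H) (ω : H) :
    Coalgebra.comul (R := ℂ) (HopfAlgebra.antipode (R := ℂ) ω) = gflip ω := by
  have h := left_inv_eq_right_inv (gflip_mul D) (LinearMap.comul_right_inv (R := ℂ) (C := H))
  have h2 := WithConv.toConv_injective h
  rw [h2]; rfl

theorem Sw_Sinv (ω : H) (F : H → H → M) (h1 : ∀ y, Lin fun x => F x y)
    (h2 : ∀ x, Lin fun y => F x y) :
    Sw D (D.Sinv ω) F = Sw D ω fun x y => F (D.Sinv y) (D.Sinv x) := by
  have k1 : ∀ y, Lin fun x => F (D.Sinv y) (D.Sinv x) := fun y => (h2 _).comp' (lin_Sinv D)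
  have k2 : ∀ x, Lin fun y => F (D.Sinv y) (D.Sinv x) := fun y => (h1 _).comp' (lin_Sinv D)
  obtain ⟨η, rfl⟩ : ∃ η, HopfAlgebra.antipode (R := ℂ) η = ω := ⟨_, D.antipode_Sinv ω⟩
  rw [D.Sinv_antipode, Sw_eq D _ _ k1 k2, comul_antipode D, gflip_apply D,
    map_Sw D (LinearMap.isLinear _)]
  refine Sw_congr D fun x y => ?_
  simp [bil, D.Sinv_antipode]

end Sweedler

section TInv

variable (D : HopfData H)

theorem regroup (ω : H) (G : H → H → H → H → H → H → ℂ)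
    (ha : ∀ b c d m z, Lin fun a => G a b c d m z) (hb : ∀ a c d m z, Lin fun b => G a b c d m z)
    (hc : ∀ a b d m z, Lin fun c => G a b c d m z) (hd : ∀ a b c m z, Lin fun d => G a b c d m z)
    (hm : ∀ a b c d z, Lin fun m => G a b c d m z) (hz : ∀ a b c d m, Lin fun z => G a b c d m z) :
    Sw D ω (fun x r => Sw D r fun y r' => Sw D r' fun m z => Sw D x fun a b => Sw D y fun c d =>
      G a b c d m z) =
    Sw D ω (fun a r => Sw D r fun w z => Sw D w fun b w' => Sw D w' fun c w'' =>
      Sw D w'' fun d m => G a b c d m z) := by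
  trans Sw D ω (fun a s => Sw D s fun b r => Sw D r fun c u => Sw D u fun d r' => Sw D r' fun m z =>
      G a b c d m z)
  · have e : ∀ x r, (Sw D r fun y r' => Sw D r' fun m z => Sw D x fun a b => Sw D y fun c d =>
        G a b c d m z) =
        Sw D x fun a b => Sw D r fun c u => Sw D u fun d r' => Sw D r' fun m z =>
          G a b c d m z := by
      intro x r
      have e1 : (fun y r' => Sw D r' fun m z => Sw D x fun a b => Sw D y fun c d =>
        G a b c d m z) = (fun y r' => Sw D x fun a b => Sw D y fun c d => Sw D r' fun m z =>
        G a b c d m z) := by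
        funext y r'
        rw [Sw_comm]
        refine Sw_congr D fun a b => ?_
        rw [Sw_comm]
      rw [e1, Sw_comm]
      refine Sw_congr D fun a b => ?_
      exact Sw_coassoc D r (fun c d r' => Sw D r' fun m z => G a b c d m z)
        (fun d r' => lin_Sw_param D _ _ fun m z => hc _ _ _ _ _)
        (fun d r' => lin_Sw_param D _ _ fun m z => hd _ _ _ _ _)
        (fun c d => lin_Sw D _ (fun z => hm _ _ _ _ _) fun m => hz _ _ _ _ _)
    simp only [e]
    exact Sw_coassoc D ω (fun a b r => Sw D r fun c u => Sw D u fun d r' => Sw D r' fun m z =>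
          G a b c d m z)
      (fun b r => lin_Sw_param D _ _ fun _ _ => lin_Sw_param D _ _ fun _ _ =>
        lin_Sw_param D _ _ fun _ _ => ha _ _ _ _ _)
      (fun b r => lin_Sw_param D _ _ fun _ _ => lin_Sw_param D _ _ fun _ _ =>
        lin_Sw_param D _ _ fun _ _ => hb _ _ _ _ _)
      (fun a b => lin_Sw D _
        (fun u => lin_Sw_param D _ _ fun _ _ => lin_Sw_param D _ _ fun _ _ => hc _ _ _ _ _)
        (fun c => lin_Sw D _ (fun _ => lin_Sw_param D _ _ fun _ _ => hd _ _ _ _ _)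
          (fun d => lin_Sw D _ (fun _ => hm _ _ _ _ _) (fun _ => hz _ _ _ _ _))))
  · refine Sw_congr D fun a r => ?_
    symm
    rw [Sw_coassoc D r (fun b w' z => Sw D w' fun c w'' => Sw D w'' fun d m => G a b c d m z)
      (fun _ _ => lin_Sw_param D _ _ fun _ _ => lin_Sw_param D _ _ fun _ _ => hb _ _ _ _ _)
      (fun _ _ => lin_Sw D _ (fun _ => lin_Sw_param D _ _ fun _ _ => hc _ _ _ _ _)
        (fun _ => lin_Sw D _ (fun _ => hd _ _ _ _ _) (fun _ => hm _ _ _ _ _)))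
      (fun _ _ => lin_Sw_param D _ _ fun _ _ => lin_Sw_param D _ _ fun _ _ => hz _ _ _ _ _)]
    refine Sw_congr D fun b s => ?_
    rw [Sw_coassoc D s (fun c w'' z => Sw D w'' fun d m => G a b c d m z)
      (fun _ _ => lin_Sw_param D _ _ fun _ _ => hc _ _ _ _ _)
      (fun _ _ => lin_Sw D _ (fun _ => hd _ _ _ _ _) (fun _ => hm _ _ _ _ _))
      (fun _ _ => lin_Sw_param D _ _ fun _ _ => hz _ _ _ _ _)]
    refine Sw_congr D fun c u => ?_
    exact Sw_coassoc D u (fun d m z => G a b c d m z) (fun _ _ => hd _ _ _ _ _)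
      (fun _ _ => hm _ _ _ _ _) (fun _ _ => hz _ _ _ _ _)

theorem tinv (F : H → H → H → ℂ) (F0 : H → H → ℂ)
    (h1 : ∀ k m, Lin fun x => F x k m) (h2 : ∀ x m, Lin fun k => F x k m)
    (h3 : ∀ x k, Lin fun m => F x k m)
    (k2 : ∀ x, Lin fun k => F0 x k)
    (hinv : ∀ ω η k, Sw D ω (fun x r => Sw D r fun y r' => Sw D r' fun z m =>
      F (D.Sinv x * η * y) (k * z) m) = epsi ω * F0 η k) (ω η : H) :
    Sw D ω (fun x r => Sw D r fun y r' => Sw D r' fun m z => Sw D (D.Sinv x * η * y) fun p q =>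
      F p (z * q) m) = epsi ω * Sw D η F0 := by
  have e1 : ∀ x y m z, (Sw D (D.Sinv x * η * y) fun p q => F p (z * q) m) =
      Sw D x fun a b => Sw D y fun c d => Sw D η fun e g =>
        F (D.Sinv b * e * c) (z * (D.Sinv a * g * d)) m := by
    intro x y m z
    have b1 : ∀ u, Lin fun p => F p (z * u) m := fun u => h1 _ _
    have b2 : ∀ p, Lin fun q => F p (z * q) m := fun p => (h2 p m).comp' (Lin.id'.mul_l z)
    rw [Sw_mul D _ _ _ b1 b2, Sw_mul D _ _ (fun p q => Sw D y fun c d => F (p * c) (z * (q * d)) m)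
      (fun u => lin_Sw_param D _ _ fun c d => (h1 _ _).comp' (Lin.id'.mul_r _))
      (fun u => lin_Sw_param D _ _ fun c d => (b2 _).comp' (Lin.id'.mul_r _)),
      Sw_Sinv D _ (fun p q => Sw D η fun e g => Sw D y fun c d =>
        F (p * e * c) (z * (q * g * d)) m)
      (fun u => lin_Sw_param D _ _ fun _ _ => lin_Sw_param D _ _ fun c d =>
        (h1 _ _).comp' ((Lin.id'.mul_r _).mul_r _))
      (fun u => lin_Sw_param D _ _ fun _ _ => lin_Sw_param D _ _ fun c d =>
        (b2 _).comp' ((Lin.id'.mul_r _).mul_r _))]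
    refine Sw_congr D fun a b => ?_
    rw [Sw_comm]
  simp only [e1]
  have lS := lin_Sinv D
  rw [regroup D ω (fun a b c d m z => Sw D η fun e g =>
        F (D.Sinv b * e * c) (z * (D.Sinv a * g * d)) m)
    (fun _ _ _ _ _ => lin_Sw_param D _ _ fun _ _ =>
      (h2 _ _).comp' (((lS.mul_r _).mul_r _).mul_l _))
    (fun _ _ _ _ _ => lin_Sw_param D _ _ fun _ _ => (h1 _ _).comp' ((lS.mul_r _).mul_r _))
    (fun _ _ _ _ _ => lin_Sw_param D _ _ fun _ _ => (h1 _ _).comp' (Lin.id'.mul_l _))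
    (fun _ _ _ _ _ => lin_Sw_param D _ _ fun _ _ =>
      (h2 _ _).comp' ((Lin.id'.mul_l _).mul_l _))
    (fun _ _ _ _ _ => lin_Sw_param D _ _ fun _ _ => h3 _ _)
    (fun _ _ _ _ _ => lin_Sw_param D _ _ fun _ _ => (h2 _ _).comp' (Lin.id'.mul_r _))]
  have e2 : ∀ a w z, (Sw D w fun b w' => Sw D w' fun c w'' =>
      Sw D w'' fun d m => Sw D η fun e g => F (D.Sinv b * e * c) (z * (D.Sinv a * g * d)) m) =
      epsi w • Sw D η fun e g => F0 e (z * D.Sinv a * g) := by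
    intro a w z
    rw [map_Sw D (Lin.id'.smul_c (epsi w))]
    simp only [smul_eq_mul, ← hinv]
    rw [Sw_comm]
    refine Sw_congr D fun b w' => ?_
    rw [Sw_comm]
    refine Sw_congr D fun c w'' => ?_
    rw [Sw_comm]
    refine Sw_congr D fun d m => ?_
    refine Sw_congr D fun e g => ?_
    simp only [mul_assoc]
  simp only [e2]
  have e3 : ∀ a r, (Sw D r fun w z => epsi w • Sw D η fun e g => F0 e (z * D.Sinv a * g)) =
      Sw D η fun e g => F0 e (r * D.Sinv a * g) := by
    intro a r
    exact Sw_counit_left D r _ (lin_Sw_param D _ _ fun _ _ =>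
      (k2 _).comp' ((Lin.id'.mul_r _).mul_r _))
  simp only [e3]
  rw [Sw_comm, ← smul_eq_mul, map_Sw D (Lin.id'.smul_c (epsi ω))]
  refine Sw_congr D fun e g => ?_
  rw [← map_Sw D ((k2 e).comp' (Lin.id'.mul_r g)), Sw_Sinv_right, smul_mul_assoc, one_mul,
    (k2 e).map_smul]

end TInv

section ActSec

variable {B : Type} [Ring B] [Algebra ℂ B] {D : HopfData H} (A : MAlg D B)

/-- multilinearity of a function of `k` variables in `B` -/
def MLf {k : ℕ} (F : (Fin k → B) → ℂ) : Prop := ∀ b i, Lin fun x => F (Function.update b i x)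

theorem isML_iff {n : ℕ} (f : Raw H B n) :
    IsML f ↔ (∀ b, Lin fun ω => f ω b) ∧ ∀ ω, MLf (f ω) := by
  constructor
  · rintro ⟨h1, h2, h3, h4⟩
    exact ⟨fun b => ⟨fun x y => h1 x y b, fun c x => h2 c x b⟩,
      fun ω b i => ⟨fun x y => h3 ω b i x y, fun c x => h4 ω b i c x⟩⟩
  · rintro ⟨h1, h2⟩
    exact ⟨fun ω η b => (h1 b).map_add ω η, fun c ω b => (h1 b).map_smul c ω,
      fun ω b i x y => (h2 ω b i).map_add x y, fun ω b i c x => (h2 ω b i).map_smul c x⟩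

theorem MLf.comp {k l : ℕ} {F : (Fin k → B) → ℂ} (hF : MLf F) (φ : (Fin l → B) → (Fin k → B))
    (h : ∀ b i, ∃ (j : Fin k) (L : B → B) (c : Fin k → B), Lin L ∧
      ∀ x, φ (Function.update b i x) = Function.update c j (L x)) :
    MLf fun b => F (φ b) := by
  intro b i
  obtain ⟨j, L, c, hL, e⟩ := h b i
  simp only [e]
  exact (hF c j).comp' hL

theorem MLf.cons {k : ℕ} {F : (Fin (k + 1) → B) → ℂ} (hF : MLf F) (x : B) :
    MLf fun c : Fin k → B => F (Fin.cons x c) :=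
  hF.comp _ fun b i => ⟨i.succ, fun y => y, Fin.cons x b, Lin.id', fun y => by
    rw [Fin.cons_update]⟩

theorem MLf.snoc {k : ℕ} {F : (Fin (k + 1) → B) → ℂ} (hF : MLf F) (x : B) :
    MLf fun c : Fin k → B => F (Fin.snoc c x) :=
  hF.comp _ fun b i => ⟨i.castSucc, fun y => y, (Fin.snoc b x : Fin (k + 1) → B), Lin.id',
    fun y => by rw [Fin.snoc_update]⟩

theorem MLf.lin_cons {k : ℕ} {F : (Fin (k + 1) → B) → ℂ} (hF : MLf F) (c : Fin k → B) :
    Lin fun x : B => F (Fin.cons x c) := by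
  have := hF (Fin.cons 0 c) 0
  simpa only [Fin.update_cons_zero] using this

theorem MLf.lin_snoc {k : ℕ} {F : (Fin (k + 1) → B) → ℂ} (hF : MLf F) (c : Fin k → B) :
    Lin fun x : B => F (Fin.snoc c x) := by
  have := hF (Fin.snoc c 0) (Fin.last k)
  simpa only [Fin.update_snoc_last] using this

theorem lin_fn_l (b : B) : Lin fun ω => A.fn ω b :=
  ⟨fun x y => by simp [MAlg.fn, RAct.fn], fun c x => by simp [MAlg.fn, RAct.fn]⟩

theorem lin_fn_r (ω : H) : Lin fun b => A.fn ω b :=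
  ⟨fun x y => by simp [MAlg.fn, RAct.fn], fun c x => by simp [MAlg.fn, RAct.fn]⟩

theorem fn_mul (ω η : H) (b : B) : A.fn (ω * η) b = A.fn η (A.fn ω b) := by
  simp [MAlg.fn, RAct.fn, A.act_mul]

theorem fn_mul_mul (ω : H) (b c : B) :
    A.fn ω (b * c) = Sw D ω fun x y => A.fn x b * A.fn y c := A.act_mul_mul ω b c

theorem fn_one (ω : H) : A.fn ω 1 = epsi ω • (1 : B) := A.act_algOne ω

/-- the diagonal action of `ω`, evaluated against `F` -/
def ActK : (k : ℕ) → H → ((Fin k → B) → ℂ) → (Fin k → B) → ℂ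
  | 0, ω, F, b => epsi ω • F b
  | k + 1, ω, F, b => Sw D ω fun x y =>
      ActK k y (fun c => F (Fin.cons (A.fn x (b 0)) c)) (fun i => b i.succ)

theorem ActK_succ (k : ℕ) (ω : H) (F : (Fin (k + 1) → B) → ℂ) (b : Fin (k + 1) → B) :
    ActK A (k + 1) ω F b = Sw D ω fun x y =>
      ActK A k y (fun c => F (Fin.cons (A.fn x (b 0)) c)) (fun i => b i.succ) := rfl

theorem ActK_linF {V : Type*} [AddCommGroup V] [Module ℂ V] (k : ℕ) (ω : H)
    (F : V → (Fin k → B) → ℂ) (h : ∀ c, Lin fun t => F t c) (b : Fin k → B) :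
    Lin fun t => ActK A k ω (F t) b := by
  induction k generalizing ω with
  | zero => exact (h b).smul_c _
  | succ k ih =>
    exact lin_Sw_param D _ _ fun x y => ih y (fun t c => F t (Fin.cons (A.fn x (b 0)) c))
      (fun c => h _) _

theorem ActK_linω (k : ℕ) (F : (Fin k → B) → ℂ) (h : MLf F) (b : Fin k → B) :
    Lin fun ω => ActK A k ω F b := by
  induction k with
  | zero => exact lin_epsi.smul_v _
  | succ k ih =>
    exact lin_Sw D _ (fun y => ActK_linF A k y _ (fun c => (h.lin_cons c).comp' (lin_fn_l A _)) _)
      (fun x => ih _ (h.cons _) _)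

theorem ActK_snoc (k : ℕ) (ω : H) (F : (Fin (k + 1) → B) → ℂ) (h : MLf F)
    (b : Fin (k + 1) → B) :
    ActK A (k + 1) ω F b = Sw D ω fun m z =>
      ActK A k m (fun c => F (Fin.snoc c (A.fn z (b (Fin.last k))))) (fun i => b i.castSucc) := by
  induction k generalizing ω with
  | zero =>
    have e1 := Sw_counit_right D ω (fun x => F fun _ => A.fn x (b 0)) (by
      have := (h.lin_cons Fin.elim0).comp' (lin_fn_l A (b 0))
      convert this using 3
      ext i; fin_cases i; rfl)
    have e2 := Sw_counit_left D ω (fun x => F fun _ => A.fn x (b 0)) (by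
      have := (h.lin_cons Fin.elim0).comp' (lin_fn_l A (b 0))
      convert this using 3
      ext i; fin_cases i; rfl)
    trans (F fun _ => A.fn ω (b 0))
    · rw [← e1]
      refine Sw_congr D fun x y => ?_
      simp only [ActK]
      congr 2
      ext i; fin_cases i; rfl
    · rw [← e2]
      refine Sw_congr D fun x y => ?_
      simp only [ActK]
      congr 2
  | succ k ih =>
    rw [ActK_succ]
    have e1 : ∀ x y, _ := fun x y => ih y _ (h.cons (A.fn x (b 0))) (fun i => b i.succ)
    simp only [e1, ActK_succ]
    rw [Sw_coassoc D ω (fun x y z => ActK A k y (fun c => F (Fin.snoc (Fin.cons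
      (A.fn x (b (Fin.castSucc 0))) c : Fin (k+1) → B) (A.fn z (b (Fin.last (k + 1))))))
        (fun i => b i.succ.castSucc))
      (fun y z => ActK_linF A k y _ (fun c => ((h.snoc _).lin_cons c).comp' (lin_fn_l A _)) _)
      (fun x z => ActK_linω A k _ ((h.snoc _).cons _) _)
      (fun x y => ActK_linF A k y _ (fun c => (h.lin_snoc _).comp' (lin_fn_l A _)) _)]
    refine Sw_congr D fun x y => Sw_congr D fun m z => ?_
    simp only [Fin.cons_snoc_eq_snoc_cons]
    rfl

theorem sw_cons (D : HopfData H) (n : ℕ) (ω : H) : D.sw (n + 1) ω =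
    (D.Δl ω).flatMap fun p => (D.sw n p.2).map fun w => (Fin.cons p.1 w : Fin (n + 2) → H) := by
  induction n with
  | zero =>
    simp only [HopfData.sw, List.flatMap_cons, List.flatMap_nil, List.append_nil, List.map_cons,
      List.map_nil]
    induction D.Δl ω with
    | nil => rfl
    | cons p l ih =>
      simp only [List.map_cons, List.flatMap_cons, ih]
      congr 1
      ext i; fin_cases i <;> rfl
  | succ n ih =>
    rw [HopfData.sw, ih]
    simp only [List.flatMap_assoc, List.flatMap_map, HopfData.sw, List.map_flatMap, List.map_map]
    congr 1
    funext p
    congr 1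
    funext w
    rw [← Fin.succ_last, Fin.cons_succ]
    congr 1
    funext q
    simp only [Function.comp_apply, Fin.cons_snoc_eq_snoc_cons, Fin.cons_update]

theorem list_flatMap_sum {α β M : Type*} [AddCommMonoid M] (l : List α) (g : α → List β) (F : β → M) :
    ((l.flatMap g).map F).sum = (l.map fun a => ((g a).map F).sum).sum := by
  induction l with
  | nil => rfl
  | cons a l ih => simp [ih]

theorem sw_cons_sum (D : HopfData H) (n : ℕ) (ω : H) (G : (Fin (n + 2) → H) → ℂ) :
    ((D.sw (n + 1) ω).map G).sum = Sw D ω fun x y =>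
      ((D.sw n y).map fun w => G (Fin.cons x w)).sum := by
  rw [sw_cons, list_flatMap_sum]
  simp only [List.map_map]
  rfl

theorem Act_eq (n : ℕ) (ω : H) (F : (Fin (n + 1) → B) → ℂ) (h : MLf F) (b : Fin (n + 1) → B) :
    ((D.sw n ω).map fun w => F fun i => A.fn (w i) (b i)).sum = ActK A (n + 1) ω F b := by
  induction n generalizing ω with
  | zero =>
    have e1 := Sw_counit_right D ω (fun x => F fun _ => A.fn x (b 0)) (by
      have := (h.lin_cons Fin.elim0).comp' (lin_fn_l A (b 0))
      convert this using 3
      ext i; fin_cases i; rfl)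
    trans (F fun _ => A.fn ω (b 0))
    · simp only [HopfData.sw, List.map_cons, List.map_nil, List.sum_cons, List.sum_nil, add_zero]
      congr 1; ext i; fin_cases i; rfl
    · rw [← e1]
      refine Sw_congr D fun x y => ?_
      simp only [ActK]
      congr 2
      ext i; fin_cases i; rfl
  | succ n ih =>
    rw [sw_cons_sum, ActK_succ]
    refine Sw_congr D fun x y => ?_
    rw [← ih y _ (h.cons _)]
    congr 2
    funext w
    congr 1
    funext i
    refine Fin.cases rfl (fun j => ?_) i
    simp

/-- Reformulation of invariance. -/
def InvK {n : ℕ} (f : Raw H B n) : Prop := ∀ (ω η : H) (b : Fin (n + 1) → B),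
  Sw D ω (fun x r => Sw D r fun y m => ActK A (n + 1) m (f (D.Sinv x * η * y)) b) = epsi ω * f η b

theorem isInv_iff {n : ℕ} (f : Raw H B n) (h : ∀ ω, MLf (f ω)) :
    IsInv D A.fn f ↔ InvK A f := by
  unfold IsInv InvK
  refine forall_congr' fun ω => forall_congr' fun η => forall_congr' fun b => ?_
  rw [sw_cons_sum]
  simp only [sw_cons_sum, ← Act_eq A n _ _ (h _)]
  rfl

end ActSec

section Ops

variable {B : Type} [Ring B] [Algebra ℂ B] {D : HopfData H} (A : MAlg D B)

/-! #### tuple combinatorics -/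

theorem ins_apply {n : ℕ} (i : Fin (n + 1)) (x : B) (b : Fin n → B) (j : Fin (n + 1)) :
    (Fin.insertNth i x b : Fin (n + 1) → B) j =
      if h : (j : ℕ) < i then b ⟨j, by have := i.isLt; omega⟩
      else if h' : (j : ℕ) = i then x
      else b ⟨(j : ℕ) - 1, by have := j.isLt; omega⟩ := by
  rcases lt_trichotomy j i with h | h | h
  · have h' : (j : ℕ) < i := h
    rw [Fin.insertNth_apply_below h]
    simp only [h', dif_pos, eq_rec_constant]
    rfl
  · subst h; simp
  · have h' : ¬ (j : ℕ) < i := by have : (i : ℕ) < j := h; omega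
    have h'' : ¬ (j : ℕ) = i := by have : (i : ℕ) < j := h; omega
    rw [Fin.insertNth_apply_above h]
    simp only [h', h'', dif_neg, eq_rec_constant, not_false_eq_true]
    rfl

theorem cons_apply' {n : ℕ} (x : B) (b : Fin n → B) (j : Fin (n + 1)) :
    (Fin.cons x b : Fin (n + 1) → B) j =
      if h : (j : ℕ) = 0 then x else b ⟨(j : ℕ) - 1, by have := j.isLt; omega⟩ := by
  refine Fin.cases ?_ (fun k => ?_) j
  · simp
  · simp

theorem snoc_apply' {n : ℕ} (x : B) (b : Fin n → B) (j : Fin (n + 1)) :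
    (Fin.snoc b x : Fin (n + 1) → B) j =
      if h : (j : ℕ) < n then b ⟨j, h⟩ else x := by
  simp only [Fin.snoc, cast_eq]
  rfl

theorem contract_zero {n : ℕ} (b : Fin (n + 2) → B) :
    contract 0 b = Fin.cons (b 0 * b 1) fun i => b i.succ.succ := by
  funext j
  refine Fin.cases ?_ (fun k => ?_) j
  · simp [contract]
  · simp [contract]

theorem contract_succ {n : ℕ} (i : Fin (n + 1)) (b : Fin (n + 3) → B) :
    contract i.succ b = Fin.cons (b 0) (contract i fun k => b k.succ) := by
  funext j
  refine Fin.cases ?_ (fun k => ?_) j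
  · simp [contract]
  · simp [contract]

theorem ins_zero {n : ℕ} (x : B) (b : Fin n → B) :
    (Fin.insertNth 0 x b : Fin (n + 1) → B) = Fin.cons x b := by
  exact Fin.insertNth_zero' x b

theorem ins_succ {n : ℕ} (i : Fin (n + 1)) (x : B) (b : Fin (n + 1) → B) :
    (Fin.insertNth i.succ x b : Fin (n + 2) → B) =
      Fin.cons (b 0) (Fin.insertNth i x fun k => b k.succ : Fin (n + 1) → B) := by
  funext j
  have h0 : ((0 : Fin (n + 1)) : ℕ) = 0 := rfl
  simp only [ins_apply, cons_apply', Fin.val_succ]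
  split_ifs <;> first
    | omega
    | rfl
    | (congr 1; apply Fin.ext; simp only [Fin.val_succ, h0]; omega)

theorem MLf.ins {k : ℕ} {F : (Fin (k + 1) → B) → ℂ} (hF : MLf F) (i : Fin (k + 1)) (x : B) :
    MLf fun c : Fin k → B => F (Fin.insertNth i x c) :=
  hF.comp _ fun b j => ⟨i.succAbove j, fun y => y, (Fin.insertNth i x b : Fin (k + 1) → B),
    Lin.id', fun y => by rw [Fin.insertNth_update]⟩

theorem MLf.contract {k : ℕ} {F : (Fin (k + 1) → B) → ℂ} (hF : MLf F) (i : Fin (k + 1)) :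
    MLf fun c : Fin (k + 2) → B => F (contract i c) := by
  refine hF.comp _ fun b j => ?_
  rcases lt_trichotomy (j : ℕ) i with h | h | h
  · refine ⟨⟨j, by omega⟩, fun y => y, _root_.contract i b, Lin.id', fun y => ?_⟩
    funext l
    simp only [_root_.contract, Function.update_apply, Fin.ext_iff, Fin.val_castSucc, Fin.val_succ]
    split_ifs <;> first | omega | rfl
  · refine ⟨⟨j, by omega⟩, fun y => y * b i.succ, _root_.contract i b, Lin.id'.mul_r _, fun y => ?_⟩
    funext l
    simp only [_root_.contract, Function.update_apply, Fin.ext_iff, Fin.val_castSucc, Fin.val_succ]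
    split_ifs <;> first | omega | rfl | (congr 2; apply Fin.ext; simp; omega)
  · by_cases h2 : (j : ℕ) = i + 1
    · refine ⟨i, fun y => b i.castSucc * y, _root_.contract i b, Lin.id'.mul_l _, fun y => ?_⟩
      funext l
      simp only [_root_.contract, Function.update_apply, Fin.ext_iff, Fin.val_castSucc,
        Fin.val_succ]
      split_ifs <;> first | omega | rfl | (congr 2; apply Fin.ext; simp; omega)
    · refine ⟨⟨(j : ℕ) - 1, by omega⟩, fun y => y, _root_.contract i b, Lin.id', fun y => ?_⟩
      funext l
      simp only [_root_.contract, Function.update_apply, Fin.ext_iff, Fin.val_castSucc,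
        Fin.val_succ]
      split_ifs <;> first | omega | rfl

/-! #### equivariance of the diagonal action -/

theorem ActK_ins (k : ℕ) (i : Fin (k + 1)) (ω : H) (F : (Fin (k + 1) → B) → ℂ) (h : MLf F)
    (b : Fin k → B) :
    ActK A k ω (fun c => F (Fin.insertNth i 1 c)) b = ActK A (k + 1) ω F (Fin.insertNth i 1 b) := by
  induction k generalizing ω with
  | zero =>
    obtain rfl : i = 0 := Fin.fin_one_eq_zero i
    rw [ActK_succ]
    simp only [ins_zero, Fin.cons_zero, Fin.cons_succ, fn_one]
    rw [← Sw_counit_left D ω _ (ActK_linω A 0 _ (h.cons 1) b)]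
    refine Sw_congr D fun x y => ?_
    rw [(ActK_linF A 0 y (fun t c => F (Fin.cons t c)) (fun c => h.lin_cons c) _).map_smul]
  | succ k ih =>
    refine Fin.cases ?_ (fun j => ?_) i
    · rw [ActK_succ A (k + 1)]
      simp only [ins_zero, Fin.cons_zero, Fin.cons_succ, fn_one]
      rw [← Sw_counit_left D ω _ (ActK_linω A (k + 1) _ (h.cons 1) b)]
      refine Sw_congr D fun x y => ?_
      rw [(ActK_linF A (k + 1) y (fun t c => F (Fin.cons t c)) (fun c => h.lin_cons c) _).map_smul]
    · rw [ActK_succ, ActK_succ A (k + 1)]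
      simp only [ins_succ, Fin.cons_zero, Fin.cons_succ]
      refine Sw_congr D fun x y => ?_
      exact ih j y _ (h.cons _) _

theorem ActK_contract (k : ℕ) (i : Fin (k + 1)) (ω : H) (F : (Fin (k + 1) → B) → ℂ) (h : MLf F)
    (b : Fin (k + 2) → B) :
    ActK A (k + 2) ω (fun c => F (contract i c)) b = ActK A (k + 1) ω F (contract i b) := by
  have key : ∀ (k : ℕ) (ω : H) (F : (Fin (k + 1) → B) → ℂ) (_ : MLf F) (b : Fin (k + 2) → B),
      ActK A (k + 2) ω (fun c => F (contract 0 c)) b = ActK A (k + 1) ω F (contract 0 b) := by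
    intro k ω F h b
    simp only [ActK_succ, contract_zero, Fin.cons_zero, Fin.cons_succ, Fin.cons_one, fn_mul_mul]
    have e : ∀ x y, (ActK A k y (fun c => F (Fin.cons
        (Sw D x fun x y => A.fn x (b 0) * A.fn y (b 1)) c)) fun i => b i.succ.succ) =
        Sw D x fun a d => ActK A k y (fun c => F (Fin.cons (A.fn a (b 0) * A.fn d (b 1)) c))
          fun i => b i.succ.succ := by
      intro x y
      exact map_Sw D (ActK_linF A k y (fun t c => F (Fin.cons t c)) (fun c => h.lin_cons c) _) x _
    simp only [e]
    rw [Sw_coassoc D ω (fun a d y => ActK A k y (fun c => F (Fin.cons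
        (A.fn a (b 0) * A.fn d (b 1)) c)) fun i => b i.succ.succ)
      (fun d y => ActK_linF A k y _ (fun c => (h.lin_cons c).comp' ((lin_fn_l A _).mul_r _)) _)
      (fun d y => ActK_linF A k y _ (fun c => (h.lin_cons c).comp' ((lin_fn_l A _).mul_l _)) _)
      (fun a d => ActK_linω A k _ (h.cons _) _)]
    rfl
  induction k generalizing ω with
  | zero =>
    obtain rfl : i = 0 := Fin.fin_one_eq_zero i
    exact key 0 ω F h b
  | succ k ih =>
    refine Fin.cases (key (k + 1) ω F h b) (fun j => ?_) i
    rw [ActK_succ, ActK_succ A (k + 1)]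
    simp only [contract_succ, Fin.cons_zero, Fin.cons_succ]
    refine Sw_congr D fun x y => ?_
    exact ih j y _ (h.cons _) _

theorem ActK_Sw (k : ℕ) (ω h : H) (F : H → H → (Fin k → B) → ℂ) (b : Fin k → B) :
    ActK A k ω (fun c => Sw D h fun p q => F p q c) b = Sw D h fun p q => ActK A k ω (F p q) b := by
  have e := map_Sw D (ActK_linF A k ω (fun t : (Fin k → B) → ℂ => t)
    (fun c => ⟨fun _ _ => rfl, fun _ _ => rfl⟩) b) h F
  rw [← e]
  congr 1
  funext c
  exact (map_Sw D (g := fun t : (Fin k → B) → ℂ => t c) ⟨fun _ _ => rfl, fun _ _ => rfl⟩ h F).symm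

/-! #### cochains -/

/-- Reformulated membership in `C^n_H(B)`. -/
structure CK {n : ℕ} (f : Raw H B n) : Prop where
  lin : ∀ b, Lin fun ω => f ω b
  ml : ∀ ω, MLf (f ω)
  inv : InvK A f

theorem inC_iff {n : ℕ} (f : Raw H B n) : InC D A.fn f ↔ CK A f := by
  unfold InC
  rw [isML_iff]
  constructor
  · rintro ⟨⟨h1, h2⟩, h3⟩
    exact ⟨h1, h2, (isInv_iff A f h2).1 h3⟩
  · rintro ⟨h1, h2, h3⟩
    exact ⟨⟨h1, h2⟩, (isInv_iff A f h2).2 h3⟩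

theorem CK.s {n : ℕ} {f : Raw H B (n + 1)} (h : CK A f) (i : Fin (n + 1)) : CK A (sRaw i f) where
  lin b := h.lin _
  ml ω := (h.ml ω).ins _ _
  inv ω η b := by
    rw [sRaw, ← h.inv]
    refine Sw_congr D fun x r => Sw_congr D fun y m => ?_
    exact ActK_ins A (n + 1) i.succ m _ (h.ml _) b

theorem CK.c {n : ℕ} {f : Raw H B n} (h : CK A f) (i : Fin (n + 1)) :
    CK A (n := n + 1) (fun ω b => f ω (contract i b)) where
  lin b := h.lin _
  ml ω := (h.ml ω).contract _
  inv ω η b := by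
    rw [← h.inv]
    refine Sw_congr D fun x r => Sw_congr D fun y m => ?_
    exact ActK_contract A n i m _ (h.ml _) b

theorem tRaw_apply {n : ℕ} (f : Raw H B n) (ω : H) (b : Fin (n + 1) → B) :
    tRaw D A.fn f ω b = Sw D ω fun p q =>
      f p (Fin.cons (A.fn q (b (Fin.last n))) fun i : Fin n => b i.castSucc) := rfl

theorem tRaw_ml {n : ℕ} {f : Raw H B n} (h : ∀ ω, MLf (f ω)) (ω : H) :
    MLf (tRaw D A.fn f ω) := by
  intro b i
  simp only [tRaw_apply]
  refine lin_Sw_param D ω (fun x p q => f p (Fin.cons (A.fn q (Function.update b i x (Fin.last n)))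
    fun l : Fin n => Function.update b i x l.castSucc)) fun p q => ?_
  refine Fin.lastCases ?_ (fun j => ?_) i
  · have : ∀ x : B, (fun i : Fin n => Function.update b (Fin.last n) x i.castSucc) =
        fun i : Fin n => b i.castSucc := by
      intro x; funext l
      rw [Function.update_of_ne (Fin.castSucc_lt_last l).ne]
    simp only [this, Function.update_self]
    exact ((h p).lin_cons _).comp' (lin_fn_r A _)
  · have : ∀ x : B, (fun i : Fin n => Function.update b j.castSucc x i.castSucc) =
        Function.update (fun i : Fin n => b i.castSucc) j x := by
      intro x; funext l
      simp [Function.update_apply]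
    simp only [this, Function.update_of_ne (Fin.castSucc_lt_last j).ne']
    exact ((h p).cons _) _ j

theorem CK.t {n : ℕ} {f : Raw H B n} (h : CK A f) : CK A (tRaw D A.fn f) where
  lin b := by
    simp only [tRaw_apply]
    exact lin_Sw D _ (fun q => h.lin _) (fun p => ((h.ml p).lin_cons _).comp' (lin_fn_l A _))
  ml := tRaw_ml A h.ml
  inv ω η b := by
    have hh := tinv D
      (fun p k m => ActK A n m (fun c => f p (Fin.cons (A.fn k (b (Fin.last n))) c))
        fun i => b i.castSucc)
      (fun p k => f p (Fin.cons (A.fn k (b (Fin.last n))) fun i => b i.castSucc))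
      (fun k m => ActK_linF A n m _ (fun c => h.lin _) _)
      (fun x m => ActK_linF A n m _ (fun c => ((h.ml x).lin_cons _).comp' (lin_fn_l A _)) _)
      (fun x k => ActK_linω A n _ ((h.ml x).cons _) _)
      (fun x => ((h.ml x).lin_cons _).comp' (lin_fn_l A _))
      (fun ω η k => by
        rw [← h.inv]
        refine Sw_congr D fun x r => Sw_congr D fun y m => ?_
        rw [ActK_succ]
        simp only [Fin.cons_zero, Fin.cons_succ, fn_mul]) ω η
    rw [tRaw_apply, ← hh]
    refine Sw_congr D fun x r => Sw_congr D fun y m => ?_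
    rw [ActK_snoc A n m _ (tRaw_ml A h.ml _) b]
    refine Sw_congr D fun m z => ?_
    simp only [tRaw_apply, Fin.snoc_last, Fin.snoc_castSucc, fn_mul]
    exact ActK_Sw A n m _ _ _

theorem dRaw_lt {n : ℕ} (i : Fin (n + 2)) (hi : (i : ℕ) < n + 1) (f : Raw H B n) :
    dRaw D A.fn i f = fun ω b => f ω (contract ⟨i, hi⟩ b) := by
  rw [dRaw, dif_pos hi]

theorem dRaw_last {n : ℕ} (i : Fin (n + 2)) (hi : (i : ℕ) = n + 1) (f : Raw H B n) :
    dRaw D A.fn i f = tRaw D A.fn (dRaw D A.fn 0 f) := by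
  rw [dRaw, dif_neg (by omega), dRaw_lt A 0 (by simp)]
  rfl

theorem CK.d {n : ℕ} {f : Raw H B n} (h : CK A f) (i : Fin (n + 2)) : CK A (dRaw D A.fn i f) := by
  by_cases hi : (i : ℕ) < n + 1
  · rw [dRaw_lt A i hi]; exact h.c A _
  · rw [dRaw_last A i (by omega), dRaw_lt A 0 (by simp)]
    exact (h.c A _).t A

end Ops

set_option linter.unusedSimpArgs false
set_option linter.unusedTactic false
set_option linter.unreachableTactic false

section Cocyc

variable {B : Type} [Ring B] [Algebra ℂ B] {D : HopfData H} (A : MAlg D B)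

theorem t_d_inner {n : ℕ} (f : Raw H B n) (i : Fin (n + 2)) (h : 1 ≤ (i : ℕ))
    (hi : (i : ℕ) < n + 1)
    (hp : (i : ℕ) - 1 < n + 2) :
    tRaw D A.fn (dRaw D A.fn i f) =
      dRaw D A.fn ⟨(i : ℕ) - 1, hp⟩ (tRaw D A.fn f) := by
  rw [dRaw_lt A i hi, dRaw_lt A _ (by first | omega | (simp only []; omega))]
  funext ω b
  simp only [tRaw_apply]
  refine Sw_congr D fun p q => ?_
  congr 1
  funext j
  simp only [contract, cons_apply', Fin.val_castSucc, Fin.val_succ, Fin.val_last]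
  split_ifs <;> first
    | contradiction
    | omega
    | rfl
    | exact congrArg b (Fin.ext (by first | omega | (simp only [Fin.val_castSucc, Fin.val_succ, Fin.val_last]; done) |
          (simp only [Fin.val_castSucc, Fin.val_succ, Fin.val_last]; omega)))
    | exact congrArg₂ (· * ·) (congrArg b (Fin.ext (by first | omega | (simp only [Fin.val_castSucc, Fin.val_succ, Fin.val_last]; done) |
          (simp only [Fin.val_castSucc, Fin.val_succ, Fin.val_last]; omega))))
        (congrArg b (Fin.ext (by first | omega | (simp only [Fin.val_castSucc, Fin.val_succ, Fin.val_last]; done) |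
          (simp only [Fin.val_castSucc, Fin.val_succ, Fin.val_last]; omega))))

theorem t_d_last {n : ℕ} (f : Raw H B n) (hl : ∀ b, Lin fun ω => f ω b) (hm : ∀ ω, MLf (f ω))
    (i : Fin (n + 2)) (hi : (i : ℕ) = n + 1)
    (hp : (i : ℕ) - 1 < n + 2) :
    tRaw D A.fn (dRaw D A.fn i f) =
      dRaw D A.fn ⟨(i : ℕ) - 1, hp⟩ (tRaw D A.fn f) := by
  rw [dRaw_last A i hi, dRaw_lt A ⟨(i : ℕ) - 1, _⟩ (by first | omega | (simp only []; omega)), dRaw_lt A 0 (by simp)]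
  funext ω b
  simp only [tRaw_apply]
  have hlast : contract (⟨(i : ℕ) - 1, by omega⟩ : Fin (n + 1)) b (Fin.last n) =
      b (Fin.last n).castSucc * b (Fin.last (n + 1)) := by
    simp only [contract, Fin.val_last]
    rw [if_neg (by omega), if_pos (by omega)]
    rfl
  rw [hlast]
  simp only [fn_mul_mul]
  have e : ∀ p q, f p (Fin.cons (Sw D q fun x y => A.fn x (b (Fin.last n).castSucc) *
        A.fn y (b (Fin.last (n + 1)))) fun l : Fin n =>
          contract (⟨(i : ℕ) - 1, by omega⟩ : Fin (n + 1)) b l.castSucc) =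
      Sw D q fun x y => f p (Fin.cons (A.fn x (b (Fin.last n).castSucc) *
        A.fn y (b (Fin.last (n + 1)))) fun l : Fin n => b l.castSucc.castSucc) := by
    intro p q
    have e2 : (fun l : Fin n => contract (⟨(i : ℕ) - 1, by omega⟩ : Fin (n + 1)) b l.castSucc) =
        fun l : Fin n => b l.castSucc.castSucc := by
      funext l
      simp only [contract, Fin.val_castSucc]
      rw [if_pos (by omega)]
    rw [e2]
    exact map_Sw D ((hm p).lin_cons _) q _
  refine Eq.trans ?_ (Sw_congr D e).symm
  rw [← Sw_coassoc D ω (fun p x y => f p (Fin.cons (A.fn x (b (Fin.last n).castSucc) *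
        A.fn y (b (Fin.last (n + 1)))) fun l : Fin n => b l.castSucc.castSucc))
    (fun _ _ => hl _)
    (fun _ _ => ((hm _).lin_cons _).comp' ((lin_fn_l A _).mul_r _))
    (fun _ _ => ((hm _).lin_cons _).comp' ((lin_fn_l A _).mul_l _))]
  refine Sw_congr D fun p q => Sw_congr D fun u v => ?_
  congr 1
  have z : Fin.last (n + 1) = (Fin.last n).succ := rfl
  have e1 : (Fin.cons (A.fn q (b (Fin.last (n + 1)))) (fun i : Fin (n + 1) => b i.castSucc) :
      Fin (n + 2) → B) (Fin.last (n + 1)) = b (Fin.last n).castSucc := by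
    rw [z, Fin.cons_succ]
  funext j
  simp only [Fin.val_zero, contract, cons_apply', Fin.val_castSucc, Fin.val_succ, Fin.val_last]
  split_ifs <;> first
    | contradiction
    | omega
    | rfl
    | (congr 1; apply Fin.ext; simp only [Fin.val_castSucc, Fin.val_succ, Fin.val_last]; omega)

theorem t_d {n : ℕ} (f : Raw H B n) (hf : CK A f) (i : Fin (n + 2)) (h : 1 ≤ (i : ℕ))
    (hp : (i : ℕ) - 1 < n + 2) :
    tRaw D A.fn (dRaw D A.fn i f) =
      dRaw D A.fn ⟨(i : ℕ) - 1, hp⟩ (tRaw D A.fn f) := by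
  by_cases hi : (i : ℕ) < n + 1
  · exact t_d_inner A f i h hi hp
  · exact t_d_last A f hf.lin hf.ml i (by have := i.isLt; omega) hp

theorem d_d_inner {n : ℕ} (f : Raw H B n) (i : Fin (n + 2)) (j : Fin (n + 3))
    (h : (i : ℕ) < (j : ℕ)) (hj : (j : ℕ) < n + 2)
    (hp : (j : ℕ) - 1 < n + 2) :
    dRaw D A.fn j (dRaw D A.fn i f) =
      dRaw D A.fn i.castSucc (dRaw D A.fn ⟨(j : ℕ) - 1, hp⟩ f) := by
  rw [dRaw_lt A j hj, dRaw_lt A i (by omega), dRaw_lt A i.castSucc (by rw [Fin.val_castSucc]; omega),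
    dRaw_lt A _ (by first | omega | (simp only []; omega))]
  funext ω b
  simp only []
  congr 1
  funext l
  simp only [contract, Fin.val_castSucc, Fin.val_succ]
  split_ifs <;> first
    | contradiction
    | omega
    | rfl
    | exact (mul_assoc _ _ _).symm

theorem d_d {n : ℕ} (f : Raw H B n) (hf : CK A f) (i : Fin (n + 2)) (j : Fin (n + 3))
    (h : (i : ℕ) < (j : ℕ))
    (hp : (j : ℕ) - 1 < n + 2) :
    dRaw D A.fn j (dRaw D A.fn i f) =
      dRaw D A.fn i.castSucc (dRaw D A.fn ⟨(j : ℕ) - 1, hp⟩ f) := by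
  by_cases hj : (j : ℕ) < n + 2
  · exact d_d_inner A f i j h hj hp
  have hj' : (j : ℕ) = n + 2 := by have := j.isLt; omega
  rw [dRaw_last A j hj', dRaw_last A ⟨(j : ℕ) - 1, _⟩ (by first | omega | (simp only []; omega))]
  by_cases hi : (i : ℕ) < n + 1
  · have e1 := d_d_inner A f 0 ⟨(i : ℕ) + 1, by omega⟩ (by simp)
      (by first | omega | (simp only []; omega)) (by first | omega | (simp only []; omega))
    have e2 := t_d A (dRaw D A.fn 0 f) (hf.d A 0) ⟨(i : ℕ) + 1, by omega⟩ (by simp)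
      (by first | omega | (simp only []; omega))
    have e1' : dRaw D A.fn 0 (dRaw D A.fn i f) =
        dRaw D A.fn ⟨(i : ℕ) + 1, by omega⟩ (dRaw D A.fn 0 f) := e1.symm
    rw [e1', e2]
    rfl
  · have hi' : (i : ℕ) = n + 1 := by have := i.isLt; omega
    have e2 := t_d A (dRaw D A.fn 0 f) (hf.d A 0) (Fin.last _) (by simp) (by simp)
    have e3 : i.castSucc = ⟨(Fin.last (n + 2) : Fin (n + 3)) - 1, by simp⟩ := by
      apply Fin.ext; simp [hi']
    rw [e3, ← e2, dRaw_last A (Fin.last (n + 2)) rfl, dRaw_last A i hi']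
    have e4 := t_d A (dRaw D A.fn 0 f) (hf.d A 0) 1 (by simp) (by simp)
    have e5 := d_d_inner A f 0 1 (by simp) (by simp) (by simp)
    have e4' : dRaw D A.fn 0 (tRaw D A.fn (dRaw D A.fn 0 f)) =
      tRaw D A.fn (dRaw D A.fn 1 (dRaw D A.fn 0 f)) := e4.symm
    have e5' : dRaw D A.fn 1 (dRaw D A.fn 0 f) = dRaw D A.fn 0 (dRaw D A.fn 0 f) := e5
    rw [e4', e5']

theorem s_s {n : ℕ} (f : Raw H B (n + 2)) (i : Fin (n + 2)) (j : Fin (n + 1))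
    (h : (i : ℕ) ≤ (j : ℕ))
    (hp : (i : ℕ) < n + 1) :
    sRaw j (sRaw i f) =
      sRaw (i := ⟨(i : ℕ), hp⟩) (sRaw j.succ f) := by
  funext ω b
  simp only [sRaw]
  congr 1
  funext l
  simp only [ins_apply, Fin.val_succ]
  split_ifs <;> first
    | contradiction
    | omega
    | rfl

theorem t_s {n : ℕ} (f : Raw H B (n + 1)) (i : Fin (n + 1)) (h : 1 ≤ (i : ℕ))
    (hp : (i : ℕ) - 1 < n + 1) :
    tRaw D A.fn (sRaw i f) =
      sRaw ⟨(i : ℕ) - 1, hp⟩ (tRaw D A.fn f) := by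
  funext ω b
  simp only [sRaw, tRaw_apply]
  refine Sw_congr D fun p q => ?_
  congr 1
  funext l
  simp only [ins_apply, cons_apply', Fin.val_succ, Fin.val_castSucc, Fin.val_last]
  split_ifs <;> first
    | contradiction
    | omega
    | rfl
    | (congr 2; apply Fin.ext; simp only [Fin.val_castSucc, Fin.val_last]; omega)
    | (congr 1; apply Fin.ext; simp only [Fin.val_castSucc, Fin.val_last]; omega)

theorem t_s_zero {n : ℕ} (f : Raw H B (n + 1)) (hf : CK A f) :
    tRaw D A.fn (sRaw 0 f) = sRaw (Fin.last n) (tRaw D A.fn (tRaw D A.fn f)) := by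
  funext ω b
  have hi : (Fin.insertNth (Fin.last n).succ 1 b : Fin (n + 2) → B) = Fin.snoc b 1 := by
    rw [Fin.succ_last, Fin.insertNth_last']
  simp only [sRaw, hi]
  rw [tRaw_apply A (tRaw D A.fn f)]
  simp only [Fin.snoc_last, Fin.snoc_castSucc, fn_one]
  have e : ∀ p q : H, tRaw D A.fn f p (Fin.cons (epsi q • (1 : B)) b) =
      epsi q • tRaw D A.fn f p (Fin.cons (1 : B) b) := fun p q =>
    ((((hf.t A).ml p).lin_cons _).map_smul _ _)
  refine Eq.trans ?_ (Sw_congr D e).symm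
  rw [Sw_counit_right D ω _ ((hf.t A).lin _)]
  simp only [tRaw_apply, sRaw]
  refine Sw_congr D fun p q => ?_
  congr 1
  have z : Fin.last (n + 1) = (Fin.last n).succ := rfl
  funext l
  simp only [ins_apply, cons_apply', Fin.val_succ, Fin.val_castSucc, Fin.val_last, Fin.val_zero]
  split_ifs <;> first
    | contradiction
    | omega
    | rfl
    | (congr 2; apply Fin.ext; simp only [Fin.val_castSucc, Fin.val_last]; omega)
    | (congr 1; apply Fin.ext; simp only [Fin.val_castSucc, Fin.val_last]; omega)

theorem s_d_lt {n : ℕ} (f : Raw H B (n + 1)) (i : Fin (n + 3)) (j : Fin (n + 2))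
    (h : (i : ℕ) < (j : ℕ))
    (hp : (i : ℕ) < n + 2) (hq : (j : ℕ) - 1 < n + 1) :
    sRaw j (dRaw D A.fn i f) = dRaw D A.fn ⟨(i : ℕ), hp⟩
      (sRaw ⟨(j : ℕ) - 1, hq⟩ f) := by
  rw [dRaw_lt A i (by omega), dRaw_lt A _ (by first | omega | (simp only []; omega))]
  funext ω b
  simp only [sRaw]
  congr 1
  funext l
  simp only [ins_apply, contract, Fin.val_succ, Fin.val_castSucc]
  split_ifs <;> first
    | contradiction
    | omega
    | rfl
    | exact congrArg b (Fin.ext (by first | omega | (simp only [Fin.val_castSucc, Fin.val_succ, Fin.val_last]; done) |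
          (simp only [Fin.val_castSucc, Fin.val_succ, Fin.val_last]; omega)))
    | exact congrArg₂ (· * ·) (congrArg b (Fin.ext (by first | omega | (simp only [Fin.val_castSucc, Fin.val_succ, Fin.val_last]; done) |
          (simp only [Fin.val_castSucc, Fin.val_succ, Fin.val_last]; omega))))
        (congrArg b (Fin.ext (by first | omega | (simp only [Fin.val_castSucc, Fin.val_succ, Fin.val_last]; done) |
          (simp only [Fin.val_castSucc, Fin.val_succ, Fin.val_last]; omega))))

theorem s_d_eq_inner {n : ℕ} (f : Raw H B (n + 1)) (i : Fin (n + 3)) (j : Fin (n + 2))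
    (h : (i : ℕ) = (j : ℕ) ∨ (i : ℕ) = (j : ℕ) + 1) (hi : (i : ℕ) < n + 2) :
    sRaw j (dRaw D A.fn i f) = f := by
  rw [dRaw_lt A i hi]
  funext ω b
  simp only [sRaw]
  congr 1
  funext l
  simp only [ins_apply, contract, Fin.val_succ, Fin.val_castSucc]
  split_ifs <;> first
    | contradiction
    | omega
    | rfl
    | exact mul_one _
    | exact one_mul _
    | (rw [mul_one]; congr 1; apply Fin.ext; simp only []; omega)
    | (rw [one_mul]; congr 1; apply Fin.ext; simp only []; omega)

theorem s_d_gt_inner {n : ℕ} (f : Raw H B (n + 1)) (i : Fin (n + 3)) (j : Fin (n + 2))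
    (h : (j : ℕ) + 1 < (i : ℕ)) (hi : (i : ℕ) < n + 2)
    (hp : (i : ℕ) - 1 < n + 2) (hq : (j : ℕ) < n + 1) :
    sRaw j (dRaw D A.fn i f) = dRaw D A.fn ⟨(i : ℕ) - 1, hp⟩
      (sRaw ⟨(j : ℕ), hq⟩ f) := by
  rw [dRaw_lt A i hi, dRaw_lt A _ (by first | omega | (simp only []; omega))]
  funext ω b
  simp only [sRaw]
  congr 1
  funext l
  simp only [ins_apply, contract, Fin.val_succ, Fin.val_castSucc]
  split_ifs <;> first
    | contradiction
    | omega
    | rfl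
    | exact congrArg b (Fin.ext (by first | omega | (simp only [Fin.val_castSucc, Fin.val_succ, Fin.val_last]; done) |
          (simp only [Fin.val_castSucc, Fin.val_succ, Fin.val_last]; omega)))
    | exact congrArg₂ (· * ·) (congrArg b (Fin.ext (by first | omega | (simp only [Fin.val_castSucc, Fin.val_succ, Fin.val_last]; done) |
          (simp only [Fin.val_castSucc, Fin.val_succ, Fin.val_last]; omega))))
        (congrArg b (Fin.ext (by first | omega | (simp only [Fin.val_castSucc, Fin.val_succ, Fin.val_last]; done) |
          (simp only [Fin.val_castSucc, Fin.val_succ, Fin.val_last]; omega))))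

theorem s_d_eq {n : ℕ} (f : Raw H B (n + 1)) (hf : CK A f) (i : Fin (n + 3)) (j : Fin (n + 2))
    (h : (i : ℕ) = (j : ℕ) ∨ (i : ℕ) = (j : ℕ) + 1) :
    sRaw j (dRaw D A.fn i f) = f := by
  by_cases hi : (i : ℕ) < n + 2
  · exact s_d_eq_inner A f i j h hi
  have hj : j = Fin.last (n + 1) := by
    apply Fin.ext; have := i.isLt; have := j.isLt; simp only [Fin.val_last]; omega
  subst hj
  rw [dRaw_last A i (by have := i.isLt; omega)]
  funext ω b
  have hs : (Fin.insertNth (Fin.last (n + 1)).succ 1 b : Fin (n + 3) → B) = Fin.snoc b 1 := by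
    rw [Fin.succ_last, Fin.insertNth_last']
  simp only [sRaw, hs]
  rw [tRaw_apply]
  simp only [Fin.snoc_last, Fin.snoc_castSucc, fn_one]
  have e : ∀ p q : H, dRaw D A.fn 0 f p (Fin.cons (epsi q • (1 : B)) b) =
      epsi q • f p b := by
    intro p q
    rw [(((hf.d A 0).ml p).lin_cons _).map_smul, dRaw_lt A 0 (by simp)]
    congr 1
    refine congrArg (f p) ?_
    refine (contract_zero (Fin.cons (1 : B) b : Fin (n + 3) → B)).trans ?_
    simp only [Fin.cons_zero, Fin.cons_succ, Fin.cons_one, one_mul]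
    exact Fin.cons_self_tail b
  refine Eq.trans (Sw_congr D e) ?_
  exact Sw_counit_right D ω (fun p => f p b) (hf.lin _)

theorem s_d_gt {n : ℕ} (f : Raw H B (n + 1)) (hf : CK A f) (i : Fin (n + 3)) (j : Fin (n + 2))
    (h : (j : ℕ) + 1 < (i : ℕ))
    (hp : (i : ℕ) - 1 < n + 2) (hq : (j : ℕ) < n + 1) :
    sRaw j (dRaw D A.fn i f) = dRaw D A.fn ⟨(i : ℕ) - 1, hp⟩
      (sRaw ⟨(j : ℕ), hq⟩ f) := by
  by_cases hi : (i : ℕ) < n + 2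
  · exact s_d_gt_inner A f i j h hi hp hq
  have hi' : (i : ℕ) = n + 2 := by have := i.isLt; omega
  rw [dRaw_last A i hi', dRaw_last A ⟨(i : ℕ) - 1, _⟩ (by first | omega | (simp only []; omega))]
  have e1 := t_s A (dRaw D A.fn 0 f) ⟨(j : ℕ) + 1, by omega⟩ (by simp)
    (by first | omega | (simp only []; omega))
  have e1' : tRaw D A.fn (sRaw ⟨(j : ℕ) + 1, by omega⟩ (dRaw D A.fn 0 f)) =
      sRaw j (tRaw D A.fn (dRaw D A.fn 0 f)) := e1
  rw [← e1', s_d_lt A f 0 ⟨(j : ℕ) + 1, by omega⟩ (by simp) (by simp)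
    (by first | omega | (simp only []; omega))]
  rfl

/-- rotated tuple -/
def rot {n : ℕ} (k : ℕ) (c : Fin k → B) (b : Fin (n + 1) → B) : Fin (n + 1) → B := fun j =>
  if h : (j : ℕ) < k then c ⟨j, h⟩ else b ⟨(j : ℕ) - k, by have := j.isLt; omega⟩

theorem rot_ml {n : ℕ} {k : ℕ} (hk : k ≤ n + 1) {F : (Fin (n + 1) → B) → ℂ} (hF : MLf F)
    (b : Fin (n + 1) → B) : MLf fun c : Fin k → B => F (rot k c b) := by
  refine hF.comp _ fun c i => ⟨⟨i, by omega⟩, fun y => y, rot k c b, Lin.id', fun y => ?_⟩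
  funext l
  simp only [rot, Function.update_apply, Fin.ext_iff]
  split_ifs <;> first
    | contradiction
    | omega
    | rfl

theorem t_iter {n : ℕ} (f : Raw H B n) (hf : CK A f) (k : ℕ) (hk : k ≤ n + 1) (ω : H)
    (b : Fin (n + 1) → B) :
    (tRaw D A.fn)^[k] f ω b = Sw D ω fun p q => ActK A k q (fun c => f p (rot k c b))
      fun i : Fin k => b ⟨n + 1 - k + i, by omega⟩ := by
  induction k generalizing ω b with
  | zero =>
    have : ∀ c : Fin 0 → B, rot 0 c b = b := by
      intro c; funext l; simp [rot]
    simp only [Function.iterate_zero, id_eq, ActK, this]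
    exact (Sw_counit_right D ω (fun p => f p b) (hf.lin _)).symm
  | succ k ih =>
    rw [Function.iterate_succ_apply', tRaw_apply]
    have e : ∀ p q, _ := fun p q => ih (by omega) p
      (Fin.cons (A.fn q (b (Fin.last n))) fun i : Fin n => b i.castSucc)
    refine Eq.trans (Sw_congr D e) ?_
    have e2 : ∀ p q, _ := fun p q => ActK_snoc A k q _ (rot_ml hk (hf.ml p) b)
      (fun i : Fin (k + 1) => b ⟨n + 1 - (k + 1) + i, by omega⟩)
    refine Eq.trans ?_ (Sw_congr D e2).symm
    rw [← Sw_coassoc D ω (fun p m z => ActK A k m (fun c => f p (rot (k + 1)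
        (Fin.snoc c (A.fn z (b ⟨n + 1 - (k + 1) + (Fin.last k : Fin (k + 1)), by
          simp only [Fin.val_last]; omega⟩)) : Fin (k + 1) → B) b))
        fun i : Fin k => b ⟨n + 1 - (k + 1) + (i.castSucc : Fin (k + 1)), by
          simp only [Fin.val_castSucc]; omega⟩)
      (fun m z => ActK_linF A k m _ (fun c => hf.lin _) _)
      (fun p z => ActK_linω A k _ ((rot_ml hk (hf.ml p) b).snoc _) _)
      (fun p m => ActK_linF A k m _
        (fun c => ((rot_ml hk (hf.ml p) b).lin_snoc c).comp' (lin_fn_l A _)) _)]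
    refine Sw_congr D fun p q => Sw_congr D fun u m => ?_
    congr 1
    · funext c
      congr 1
      funext l
      simp only [rot, cons_apply', snoc_apply', Fin.val_last]
      split_ifs <;> first
        | omega
        | rfl
        | (congr 2; apply Fin.ext; simp only [Fin.val_last]; omega)
        | (congr 1; apply Fin.ext; simp only [Fin.val_castSucc]; omega)
    · funext l
      simp only [cons_apply']
      rw [dif_neg (by omega)]
      congr 1
      apply Fin.ext
      simp only [Fin.val_castSucc]
      omega

theorem t_pow {n : ℕ} (f : Raw H B n) (hf : CK A f) : (tRaw D A.fn)^[n + 1] f = f := by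
  funext ω b
  rw [t_iter A f hf (n + 1) le_rfl]
  have e1 : ∀ c : Fin (n + 1) → B, rot (n + 1) c b = c := by
    intro c; funext l; simp only [rot, l.isLt, dif_pos]
  have e2 : (fun i : Fin (n + 1) => b ⟨n + 1 - (n + 1) + i, by omega⟩) = b := by
    funext l; congr 1; apply Fin.ext; simp
  simp only [e1]
  rw [e2, ← Sw_counit_right D ω (fun p => f p b) (hf.lin _)]
  have hinv := hf.inv
  unfold InvK at hinv
  simp only [smul_eq_mul, ← hinv]
  have lS := lin_Sinv D
  rw [← Sw_coassoc D ω (fun x u r => Sw D r fun v m => ActK A (n + 1) m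
      (f (D.Sinv u * x * v)) b)
    (fun u r => lin_Sw_param D _ _ fun v m => ActK_linF A _ m (fun x => f (D.Sinv u * x * v))
      (fun c => (hf.lin c).comp' ((Lin.id'.mul_l _).mul_r _)) _)
    (fun x r => lin_Sw_param D _ _ fun v m => ActK_linF A _ m (fun u => f (D.Sinv u * x * v))
      (fun c => (hf.lin c).comp' ((lS.mul_r _).mul_r _)) _)
    (fun x u => lin_Sw D _
      (fun m => ActK_linF A _ m (fun v => f (D.Sinv u * x * v))
        (fun c => (hf.lin c).comp' (Lin.id'.mul_l _)) _)
      (fun v => ActK_linω A _ _ (hf.ml _) _))]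
  have e3 : ∀ w r, (Sw D w fun x u => Sw D r fun v m => ActK A (n + 1) m
      (f (D.Sinv u * x * v)) b) = epsi w • Sw D r fun v m => ActK A (n + 1) m (f v) b := by
    intro w r
    have l : Lin fun t : H => Sw D r fun v m => ActK A (n + 1) m (f (t * v)) b :=
      lin_Sw_param D _ _ fun v m => ActK_linF A _ m (fun t => f (t * v))
        (fun c => (hf.lin c).comp' (Lin.id'.mul_r _)) _
    rw [← map_Sw D l w (fun x u => D.Sinv u * x), Sw_Sinv_left, l.map_smul]
    simp only [one_mul]
  refine Eq.trans ?_ (Sw_congr D e3).symm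
  exact (Sw_counit_left D ω (fun r => Sw D r fun v m => ActK A (n + 1) m (f v) b)
    (lin_Sw D _ (fun m => ActK_linF A _ m f (fun c => hf.lin c) _)
      (fun v => ActK_linω A _ _ (hf.ml _) _))).symm

end Cocyc
/-- the operators `tₙ`, `dⁿᵢ`, `sⁿᵢ` define a cocyclic object on the
spaces `C^n_H(B)`: they preserve the cochain spaces, satisfy the cosimplicial
identities, the compatibilities with `t`, and `tₙ^{n+1} = id`. -/
theorem equivariant_cocyclic_object
    {H : Type} [Ring H] [HopfAlgebra ℂ H] (D : HopfData H)
    {B : Type} [Ring B] [Algebra ℂ B] (A : MAlg D B) :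
    -- the operators map cochains to cochains
    (∀ (n : ℕ) (f : Raw H B n), InC D A.fn f → InC D A.fn (tRaw D A.fn f)) ∧
    (∀ (n : ℕ) (i : Fin (n + 2)) (f : Raw H B n), InC D A.fn f →
      InC D A.fn (dRaw D A.fn i f)) ∧
    (∀ (n : ℕ) (i : Fin (n + 1)) (f : Raw H B (n + 1)), InC D A.fn f →
      InC D A.fn (sRaw i f)) ∧
    -- dⁿⱼ dⁿ⁻¹ᵢ = dⁿᵢ dⁿ⁻¹_{j-1} for i < j
    (∀ (n : ℕ) (f : Raw H B n), InC D A.fn f →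
      ∀ (i : Fin (n + 2)) (j : Fin (n + 3)) (h : (i : ℕ) < (j : ℕ)),
        dRaw D A.fn j (dRaw D A.fn i f) =
          dRaw D A.fn i.castSucc
            (dRaw D A.fn ⟨(j : ℕ) - 1, by have := j.isLt; omega⟩ f)) ∧
    -- sⁿⱼ sⁿ⁺¹ᵢ = sⁿᵢ sⁿ⁺¹_{j+1} for i ≤ j
    (∀ (n : ℕ) (f : Raw H B (n + 2)), InC D A.fn f →
      ∀ (i : Fin (n + 2)) (j : Fin (n + 1)) (h : (i : ℕ) ≤ (j : ℕ)),
        sRaw j (sRaw i f) =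
          sRaw (i := ⟨(i : ℕ), by have := j.isLt; omega⟩) (sRaw j.succ f)) ∧
    -- sⁿⱼ dⁿ⁺¹ᵢ = dⁿᵢ sⁿ⁻¹_{j-1} (i < j);  = id (i = j or i = j+1);
    -- = dⁿ_{i-1} sⁿ⁻¹ⱼ (i > j+1)
    (∀ (n : ℕ) (f : Raw H B (n + 1)), InC D A.fn f →
      ∀ (i : Fin (n + 3)) (j : Fin (n + 2)),
        (∀ h : (i : ℕ) < (j : ℕ),
          sRaw j (dRaw D A.fn i f) =
            dRaw D A.fn ⟨(i : ℕ), by have := j.isLt; omega⟩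
              (sRaw ⟨(j : ℕ) - 1, by have := j.isLt; omega⟩ f)) ∧
        (((i : ℕ) = (j : ℕ) ∨ (i : ℕ) = (j : ℕ) + 1) →
          sRaw j (dRaw D A.fn i f) = f) ∧
        (∀ h : (j : ℕ) + 1 < (i : ℕ),
          sRaw j (dRaw D A.fn i f) =
            dRaw D A.fn ⟨(i : ℕ) - 1, by have := i.isLt; omega⟩
              (sRaw ⟨(j : ℕ), by have := i.isLt; omega⟩ f))) ∧
    -- tₙ dⁿᵢ = dⁿ_{i-1} t_{n-1} for i ≥ 1, and tₙ dⁿ₀ = dⁿₙ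
    (∀ (n : ℕ) (f : Raw H B n), InC D A.fn f →
      ∀ (i : Fin (n + 2)) (h : 1 ≤ (i : ℕ)),
        tRaw D A.fn (dRaw D A.fn i f) =
          dRaw D A.fn ⟨(i : ℕ) - 1, by have := i.isLt; omega⟩ (tRaw D A.fn f)) ∧
    (∀ (n : ℕ) (f : Raw H B n), InC D A.fn f →
      tRaw D A.fn (dRaw D A.fn 0 f) = dRaw D A.fn (Fin.last (n + 1)) f) ∧
    -- tₙ sⁿᵢ = sⁿ_{i-1} t_{n+1} for i ≥ 1, and tₙ sⁿ₀ = sⁿₙ t²_{n+1}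
    (∀ (n : ℕ) (f : Raw H B (n + 1)), InC D A.fn f →
      ∀ (i : Fin (n + 1)) (h : 1 ≤ (i : ℕ)),
        tRaw D A.fn (sRaw i f) =
          sRaw ⟨(i : ℕ) - 1, by have := i.isLt; omega⟩ (tRaw D A.fn f)) ∧
    (∀ (n : ℕ) (f : Raw H B (n + 1)), InC D A.fn f →
      tRaw D A.fn (sRaw 0 f) = sRaw (Fin.last n) (tRaw D A.fn (tRaw D A.fn f))) ∧
    -- tₙ^{n+1} = id
    (∀ (n : ℕ) (f : Raw H B n), InC D A.fn f → (tRaw D A.fn)^[n + 1] f = f) := by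
  simp only [inC_iff A]
  exact ⟨fun n f hf => hf.t A, fun n i f hf => hf.d A i, fun n i f hf => hf.s A i,
    fun n f hf i j h => d_d A f hf i j h _,
    fun n f _ i j h => s_s f i j h _,
    fun n f hf i j => ⟨fun h => s_d_lt A f i j h _ _, fun h => s_d_eq A f hf i j h,
      fun h => s_d_gt A f hf i j h _ _⟩,
    fun n f hf i h => t_d A f hf i h _,
    fun n f _ => (dRaw_last A (Fin.last (n + 1)) rfl f).symm,
    fun n f _ i h => t_s A f i h _,
    fun n f hf => t_s_zero A f hf,
    fun n f hf => t_pow A f hf⟩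

end
end

section
/- For every f ∈ C^n_H(B), t_n^{n+1} f = f; explicitly, f(ω_(0) ⊗ b₀◁ω_(1) ⊗ ⋯ ⊗ bₙ◁ω_(n+1)) = f(ω ⊗ b₀ ⊗ ⋯ ⊗ bₙ) for all ω ∈ H and b₀,…,bₙ ∈ B. -/
open scoped TensorProduct

noncomputable section

variable {H : Type} [Ring H] [HopfAlgebra ℂ H]

section Aux

variable {H : Type} [Ring H] [HopfAlgebra ℂ H]

/-- contraction of a bilinear map with the comultiplication, linear in the bilinear map -/
def cm (M : Type) [AddCommGroup M] [Module ℂ M] :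
    (H →ₗ[ℂ] H →ₗ[ℂ] M) →ₗ[ℂ] (H →ₗ[ℂ] M) where
  toFun Φ := TensorProduct.lift Φ ∘ₗ Coalgebra.comul
  map_add' Φ Ψ := by
    rw [show TensorProduct.lift (Φ + Ψ) = TensorProduct.lift Φ + TensorProduct.lift Ψ by
      ext; simp, LinearMap.add_comp]
  map_smul' c Φ := by
    rw [show TensorProduct.lift (c • Φ) = c • TensorProduct.lift Φ by
      ext; simp, LinearMap.smul_comp]; rfl

lemma cm_def {M : Type} [AddCommGroup M] [Module ℂ M] (Φ : H →ₗ[ℂ] H →ₗ[ℂ] M) (ω : H) :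
    cm M Φ ω = TensorProduct.lift Φ (Coalgebra.comul (R := ℂ) ω) := rfl

lemma cm_apply (D : HopfData H) {M : Type} [AddCommGroup M] [Module ℂ M]
    (Φ : H →ₗ[ℂ] H →ₗ[ℂ] M) (ω : H) :
    cm M Φ ω = ((D.Δl ω).map fun p => Φ p.1 p.2).sum := by
  rw [cm_def, D.Δl_repr, map_list_sum, List.map_map]
  rfl

lemma cm_coassoc {M : Type} [AddCommGroup M] [Module ℂ M]
    (T : H →ₗ[ℂ] H →ₗ[ℂ] H →ₗ[ℂ] M) :
    cm M (cm (H →ₗ[ℂ] M) T) = cm M (cm M ∘ₗ T) := by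
  ext ω
  rw [cm_def, cm_def]
  have h1 : TensorProduct.lift (cm (H →ₗ[ℂ] M) T) =
      TensorProduct.lift (TensorProduct.lift T) ∘ₗ
        (Coalgebra.comul (R := ℂ) (A := H)).rTensor H := by
    ext x y; simp [cm_def]
  have h2 : TensorProduct.lift (cm M ∘ₗ T) ∘ₗ LinearMap.id =
      (TensorProduct.lift (TensorProduct.lift T) ∘ₗ
        (TensorProduct.assoc ℂ H H H).symm.toLinearMap) ∘ₗ
        (Coalgebra.comul (R := ℂ) (A := H)).lTensor H := by
    ext x y
    simp only [LinearMap.comp_id, TensorProduct.AlgebraTensorModule.curry_apply,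
      LinearMap.restrictScalars_self, TensorProduct.curry_apply, TensorProduct.lift.tmul,
      LinearMap.comp_apply, LinearMap.lTensor_tmul, cm_def]
    generalize Coalgebra.comul (R := ℂ) y = z
    induction z with
    | zero => simp
    | tmul a b => simp
    | add a b ha hb => simp only [map_add, TensorProduct.tmul_add, ha, hb]
  rw [LinearMap.comp_id] at h2
  rw [h1, h2]
  simp only [LinearMap.comp_apply]
  rw [← Coalgebra.coassoc_apply]
  simp

/-- the iterated contraction -/
def swL : (k : ℕ) → (M : Type) → [AddCommGroup M] → [Module ℂ M] →
    MultilinearMap ℂ (fun _ : Fin (k + 1) => H) M →ₗ[ℂ] (H →ₗ[ℂ] M)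
  | 0, M, _, _ =>
    { toFun := fun F =>
        { toFun := fun x => F.curryLeft x Fin.elim0
          map_add' := by intros; simp only [map_add]; rfl
          map_smul' := by intros; simp only [map_smul]; rfl }
      map_add' := fun _ _ => rfl
      map_smul' := fun _ _ => rfl }
  | k + 1, M, _, _ =>
    { toFun := fun F => cm M (swL k M ∘ₗ F.curryLeft)
      map_add' := fun F G => by
        rw [← map_add]
        congr 1
        ext x y
        exact congrArg (· y) (map_add (swL k M) (F.curryLeft x) (G.curryLeft x))
      map_smul' := fun c F => by
        rw [RingHom.id_apply, ← map_smul]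
        congr 1
        ext x y
        exact congrArg (· y) (map_smul (swL k M) c (F.curryLeft x)) }

lemma swL_succ (k : ℕ) {M : Type} [AddCommGroup M] [Module ℂ M]
    (F : MultilinearMap ℂ (fun _ : Fin (k + 2) => H) M) :
    swL (k + 1) M F = cm M (swL k M ∘ₗ F.curryLeft) := rfl

lemma sum_flatMap_aux {X Y M : Type} [AddCommMonoid M] (l : List X) (F : X → List Y)
    (g : Y → M) :
    ((l.flatMap F).map g).sum = (l.map fun x => ((F x).map g).sum).sum := by
  induction l with
  | nil => rfl
  | cons a l ih => simp [List.flatMap_cons, ih]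

lemma sw_succ (D : HopfData H) (k : ℕ) (ω : H) :
    D.sw (k + 1) ω = (D.Δl ω).flatMap fun p =>
      (D.sw k p.2).map fun v => (Fin.cons p.1 v : Fin (k + 2) → H) := by
  induction k generalizing ω with
  | zero =>
    simp only [HopfData.sw, List.flatMap_cons, List.flatMap_nil, List.append_nil, List.map_cons,
      List.map_nil]
    rw [← List.map_eq_flatMap]
    apply List.map_congr_left
    intro p _
    ext i
    fin_cases i <;> rfl
  | succ k ih =>
    rw [HopfData.sw, ih, List.flatMap_assoc]
    congr 1
    ext1 p
    rw [HopfData.sw, List.flatMap_map, List.map_flatMap]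
    congr 1
    ext1 v
    rw [List.map_map, ← Fin.succ_last, Fin.cons_succ]
    congr 1
    ext1 q
    simp only [Function.comp]
    rw [← Fin.cons_update, Fin.cons_snoc_eq_snoc_cons]

lemma swL_apply (D : HopfData H) (k : ℕ) {M : Type} [AddCommGroup M] [Module ℂ M]
    (F : MultilinearMap ℂ (fun _ : Fin (k + 1) => H) M) (ω : H) :
    ((D.sw k ω).map fun v => F v).sum = swL k M F ω := by
  induction k generalizing ω with
  | zero =>
    simp only [HopfData.sw, List.map_cons, List.map_nil, List.sum_cons, List.sum_nil, add_zero]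
    change F _ = F (Fin.cons ω Fin.elim0)
    congr 1
    ext i
    fin_cases i
    rfl
  | succ k ih =>
    rw [swL_succ, cm_apply D, sw_succ, sum_flatMap_aux]
    congr 1
    apply List.map_congr_left
    intro p _
    rw [List.map_map]
    exact ih (F.curryLeft p.1) p.2

lemma swL_succ' (k : ℕ) {M : Type} [AddCommGroup M] [Module ℂ M]
    (F : MultilinearMap ℂ (fun _ : Fin (k + 2) => H) M) :
    swL (k + 1) M F = cm M (swL k (H →ₗ[ℂ] M) F.curryRight) := by
  induction k with
  | zero =>
    rw [swL_succ]
    congr 1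
    ext x y
    change F _ = F _
    congr 1
    ext i
    fin_cases i <;> rfl
  | succ k ih =>
    rw [swL_succ, swL_succ, cm_coassoc]
    congr 1
    ext1 x
    rw [LinearMap.comp_apply, LinearMap.comp_apply, ih, LinearMap.comp_apply]
    congr 2
    ext v y
    change F _ = F _
    congr 1
    exact Fin.cons_snoc_eq_snoc_cons _ _ _

lemma Sinv_mul_s5 (D : HopfData H) (ω : H) :
    ((D.Δl ω).map fun p => D.Sinv p.2 * p.1).sum = epsi ω • (1 : H) := by
  have h := HopfAlgebra.mul_antipode_rTensor_comul_apply (R := ℂ) ω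
  rw [D.Δl_repr, map_list_sum, map_list_sum, List.map_map, List.map_map] at h
  have h2 : HopfAlgebra.antipode ℂ ((D.Δl ω).map fun p => D.Sinv p.2 * p.1).sum
      = epsi ω • (1 : H) := by
    rw [map_list_sum, List.map_map, ← Algebra.algebraMap_eq_smul_one]
    refine Eq.trans ?_ h
    congr 1
    apply List.map_congr_left
    intro p _
    simp [HopfAlgebra.antipode_mul_antidistrib, D.antipode_Sinv]
  have h3 := congrArg D.Sinv h2
  rw [D.Sinv_antipode, map_smul] at h3
  rw [h3]
  congr 1
  have := D.Sinv_antipode 1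
  rwa [HopfAlgebra.antipode_one] at this

lemma cm_counit_left {M : Type} [AddCommGroup M] [Module ℂ M] (g : H →ₗ[ℂ] M) :
    cm M ((LinearMap.lsmul ℂ (H →ₗ[ℂ] M)).flip g ∘ₗ (Coalgebra.counit (R := ℂ) (A := H))) = g := by
  ext ω
  rw [cm_def]
  have : TensorProduct.lift ((LinearMap.lsmul ℂ (H →ₗ[ℂ] M)).flip g ∘ₗ
      (Coalgebra.counit (R := ℂ) (A := H))) = g ∘ₗ (TensorProduct.lid ℂ H).toLinearMap ∘ₗ
      (Coalgebra.counit (R := ℂ) (A := H)).rTensor H := by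
    ext x y; simp
  rw [this]
  simp

lemma cm_counit_right (D : HopfData H) (g : H →ₗ[ℂ] ℂ) (ω : H) :
    ((D.Δl ω).map fun p => epsi p.2 * g p.1).sum = g ω := by
  have h := Coalgebra.lTensor_counit_comul (R := ℂ) ω
  rw [D.Δl_repr, map_list_sum, List.map_map] at h
  have h2 := congrArg (fun z => g (TensorProduct.rid ℂ H z)) h
  simp only [TensorProduct.rid_tmul, one_smul, map_list_sum, List.map_map] at h2
  rw [← h2]
  congr 1
  apply List.map_congr_left
  intro p _
  simp [epsi]

variable {B : Type} [Ring B] [Algebra ℂ B] {n : ℕ}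

/-- the arguments after `k` rotations -/
def cfun (A : H →ₗ[ℂ] B →ₗ[ℂ] B) (k : ℕ) (hk : k ≤ n + 1) (v : Fin (k + 1) → H)
    (b : Fin (n + 1) → B) : Fin (n + 1) → B := fun i =>
  if h : (i : ℕ) < k then A (v ⟨i + 1, by omega⟩) (b ⟨i + (n + 1 - k), by omega⟩)
  else b ⟨i - k, by omega⟩

lemma cfun_rot (A : H →ₗ[ℂ] B →ₗ[ℂ] B) (k : ℕ) (hk : k + 1 ≤ n + 1) (v : Fin (k + 1) → H) (p : H)
    (b : Fin (n + 1) → B) :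
    cfun A k (by omega) v (Fin.cons (A p (b (Fin.last n))) fun i : Fin n => b i.castSucc)
      = cfun A (k + 1) hk (Fin.snoc v p) b := by
  ext i
  unfold cfun
  rcases lt_trichotomy (i : ℕ) k with h | h | h
  · rw [dif_pos h, dif_pos (by omega)]
    have e1 : (⟨i + (n + 1 - k), by omega⟩ : Fin (n + 1)) =
      Fin.succ ⟨i + (n - k), by omega⟩ := by ext; simp; omega
    have e2 : (⟨i + 1, by omega⟩ : Fin (k + 2)) = Fin.castSucc ⟨i + 1, by omega⟩ := rfl
    rw [e1, Fin.cons_succ, e2, Fin.snoc_castSucc]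
    congr 2
    ext; simp
  · rw [dif_neg (by omega), dif_pos (by omega)]
    have e1 : (⟨i - k, by omega⟩ : Fin (n + 1)) = 0 := by ext; simp; omega
    have e2 : (⟨i + 1, by omega⟩ : Fin (k + 2)) = Fin.last (k + 1) := by ext; simp; omega
    rw [e1, Fin.cons_zero, e2, Fin.snoc_last]
    congr 2
    ext; simp; omega
  · rw [dif_neg (by omega), dif_neg (by omega)]
    have e1 : (⟨i - k, by omega⟩ : Fin (n + 1)) =
      Fin.succ ⟨i - (k + 1), by omega⟩ := by ext; simp; omega
    rw [e1, Fin.cons_succ]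
    rfl

lemma cfun_update_zero (A : H →ₗ[ℂ] B →ₗ[ℂ] B) (k : ℕ) (hk : k ≤ n + 1) (v : Fin (k + 1) → H)
    (x : H) (b : Fin (n + 1) → B) :
    cfun A k hk (Function.update v 0 x) b = cfun A k hk v b := by
  ext i
  unfold cfun
  split_ifs with h
  · rw [Function.update_of_ne]
    exact fun e => absurd (congrArg Fin.val e) (Nat.succ_ne_zero _)
  · rfl

lemma cfun_update_succ (A : H →ₗ[ℂ] B →ₗ[ℂ] B) (k : ℕ) (hk : k ≤ n + 1) (v : Fin (k + 1) → H)
    (x : H) (b : Fin (n + 1) → B) (j : Fin k) :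
    cfun A k hk (Function.update v j.succ x) b =
      Function.update (cfun A k hk v b) ⟨j, by omega⟩
        (A x (b ⟨j + (n + 1 - k), by omega⟩)) := by
  ext i
  by_cases hij : (i : ℕ) = j
  · obtain ⟨i, hi⟩ := i
    simp only at hij
    subst hij
    rw [Function.update_self]
    unfold cfun
    rw [dif_pos j.2]
    congr 2
    exact Function.update_self _ _ _
  · rw [Function.update_of_ne (fun e => hij (congrArg Fin.val e))]
    unfold cfun
    split_ifs with h
    · rw [Function.update_of_ne]
      exact fun e => hij (Nat.succ_injective (congrArg Fin.val e))
    · rfl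

/-- the multilinear map in the `H`-variables -/
def Fk (A : H →ₗ[ℂ] B →ₗ[ℂ] B) (f : Raw H B n) (hf : IsML f) (k : ℕ) (hk : k ≤ n + 1)
    (b : Fin (n + 1) → B) : MultilinearMap ℂ (fun _ : Fin (k + 1) => H) ℂ :=
  MultilinearMap.mk' (fun v => f (v 0) (cfun A k hk v b))
    (by
      intro v j x y
      induction j using Fin.cases with
      | zero => simp only [Function.update_self, cfun_update_zero, hf.1]
      | succ j =>
        simp only [cfun_update_succ, Function.update_of_ne (Fin.succ_ne_zero j).symm,
          map_add, LinearMap.add_apply, hf.2.2.1])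
    (by
      intro v j c x
      induction j using Fin.cases with
      | zero => simp only [Function.update_self, cfun_update_zero, hf.2.1, smul_eq_mul]
      | succ j =>
        simp only [cfun_update_succ, Function.update_of_ne (Fin.succ_ne_zero j).symm,
          map_smul, LinearMap.smul_apply, hf.2.2.2, smul_eq_mul])

lemma Fk_apply (A : H →ₗ[ℂ] B →ₗ[ℂ] B) (f : Raw H B n) (hf : IsML f) (k : ℕ) (hk : k ≤ n + 1)
    (b : Fin (n + 1) → B) (v : Fin (k + 1) → H) :
    Fk A f hf k hk b v = f (v 0) (cfun A k hk v b) := rfl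

lemma Fk_last (A : H →ₗ[ℂ] B →ₗ[ℂ] B) (f : Raw H B n) (hf : IsML f)
    (b : Fin (n + 1) → B) (v : Fin (n + 2) → H) :
    Fk A f hf (n + 1) le_rfl b v = f (v 0) fun i => A (v i.succ) (b i) := by
  rw [Fk_apply]
  congr 1
  ext i
  unfold cfun
  rw [dif_pos i.2]
  simp only [Nat.sub_self, Nat.add_zero, Fin.eta]
  rfl

lemma iter_eq (D : HopfData H) (A : MAlg D B) (f : Raw H B n) (hf : IsML f) (k : ℕ)
    (hk : k ≤ n + 1) (ω : H) (b : Fin (n + 1) → B) :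
    (tRaw D A.fn)^[k] f ω b = swL k ℂ (Fk A.act f hf k hk b) ω := by
  induction k generalizing ω b with
  | zero =>
    change f ω b = f ω _
    congr 1
  | succ k ih =>
    rw [Function.iterate_succ_apply', swL_succ', cm_apply D]
    unfold tRaw
    congr 1
    apply List.map_congr_left
    intro p _
    have := ih (by omega) p.1
      (Fin.cons (A.fn p.2 (b (Fin.last n))) fun i : Fin n => b i.castSucc)
    refine this.trans ?_
    rw [← swL_apply D, ← swL_apply D]
    refine Eq.trans ?_ (map_list_sum (LinearMap.applyₗ (R := ℂ) (M₂ := ℂ) p.2) _).symm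
    rw [List.map_map]
    congr 1
    apply List.map_congr_left
    intro v _
    change f (v 0) (cfun A.act k _ v (Fin.cons (A.act p.2 (b (Fin.last n))) _)) =
      f ((Fin.snoc v p.2 : Fin (k + 2) → H) 0) (cfun A.act (k + 1) hk (Fin.snoc v p.2) b)
    rw [cfun_rot A.act k hk]
    rfl

lemma key (D : HopfData H) (A : MAlg D B) (f : Raw H B n) (hf : InC D A.fn f) (ω : H)
    (b : Fin (n + 1) → B) :
    swL (n + 1) ℂ (Fk A.act f hf.1 (n + 1) le_rfl b) ω = f ω b := by
  set F := Fk A.act f hf.1 (n + 1) le_rfl b with hF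
  set G : H →ₗ[ℂ] H →ₗ[ℂ] ℂ := swL n ℂ ∘ₗ F.curryLeft with hG
  rw [swL_succ, ← hG]
  -- linear functional `f (·, b)`
  let g : H →ₗ[ℂ] ℂ :=
    { toFun := fun x => f x b
      map_add' := fun x y => hf.1.1 x y b
      map_smul' := fun c x => hf.1.2.1 c x b }
  -- the trilinear map
  let P : H →ₗ[ℂ] (H →ₗ[ℂ] ℂ) :=
    { toFun := fun u => cm ℂ (G ∘ₗ LinearMap.mulLeft ℂ u)
      map_add' := fun u w => by
        rw [← map_add]; congr 1; ext x y; simp [add_mul]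
      map_smul' := fun c u => by
        rw [RingHom.id_apply, ← map_smul]; congr 1; ext x y; simp }
  let T : H →ₗ[ℂ] H →ₗ[ℂ] H →ₗ[ℂ] ℂ :=
    ((LinearMap.mul ℂ H).flip.compl₂ D.Sinv).compr₂ P
  have hT : ∀ a s, T a s = P (D.Sinv s * a) := fun a s => rfl
  have h := LinearMap.congr_fun (cm_coassoc T) ω
  -- left side
  have hl : cm (H →ₗ[ℂ] ℂ) T =
      (LinearMap.lsmul ℂ (H →ₗ[ℂ] ℂ)).flip (cm ℂ G) ∘ₗ (Coalgebra.counit (R := ℂ) (A := H)) := by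
    refine LinearMap.ext fun x => ?_
    rw [cm_apply D]
    simp only [hT]
    have e := congrArg P (Sinv_mul_s5 D x)
    rw [map_list_sum, List.map_map] at e
    refine Eq.trans e ?_
    rw [map_smul]
    change epsi x • cm ℂ (G ∘ₗ LinearMap.mulLeft ℂ 1) = epsi x • cm ℂ G
    rw [LinearMap.mulLeft_one, LinearMap.comp_id]
  rw [hl, cm_counit_left] at h
  rw [h, cm_apply D]
  refine Eq.trans ?_ (cm_counit_right D g ω)
  congr 1
  apply List.map_congr_left
  intro r _
  refine Eq.trans ?_ (hf.2 r.2 r.1 b)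
  rw [LinearMap.comp_apply, cm_apply D, sw_succ, sum_flatMap_aux]
  congr 1
  apply List.map_congr_left
  intro p _
  rw [hT]
  change cm ℂ (G ∘ₗ LinearMap.mulLeft ℂ (D.Sinv p.1 * r.1)) p.2 = _
  rw [cm_apply D, List.map_map, sw_succ, sum_flatMap_aux]
  congr 1
  apply List.map_congr_left
  intro q _
  rw [List.map_map]
  change swL n ℂ (F.curryLeft (D.Sinv p.1 * r.1 * q.1)) q.2 = _
  rw [← swL_apply D]
  congr 1
  apply List.map_congr_left
  intro v _
  rw [MultilinearMap.curryLeft_apply, hF, Fk_last]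
  rfl

end Aux

/-- for `f ∈ C^n_H(B)`, `tₙ^{n+1} f = f`; explicitly,
`f(ω₍₀₎ ⊗ b₀ ◁ ω₍₁₎ ⊗ ⋯ ⊗ bₙ ◁ ω₍ₙ₊₁₎) = f(ω ⊗ b₀ ⊗ ⋯ ⊗ bₙ)`. -/
theorem cyclic_operator_power_eq_id
    {H : Type} [Ring H] [HopfAlgebra ℂ H] (D : HopfData H)
    {B : Type} [Ring B] [Algebra ℂ B] (A : MAlg D B)
    (n : ℕ) (f : Raw H B n) (hf : InC D A.fn f) :
    (tRaw D A.fn)^[n + 1] f = f ∧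
    ∀ (ω : H) (b : Fin (n + 1) → B),
      ((D.sw (n + 1) ω).map fun v => f (v 0) fun i => A.fn (v i.succ) (b i)).sum
        = f ω b := by
  refine ⟨?_, ?_⟩
  · funext ω b
    rw [iter_eq D A f hf.1 (n + 1) le_rfl, key D A f hf]
  · intro ω b
    rw [← key D A f hf ω b, ← swL_apply D]
    congr 1
    apply List.map_congr_left
    intro v _
    rw [Fk_last]
    rfl

end
end
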